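/- For every integer n ≥ 5, the generalised Higman group H_n is acylindrically hyperbolic: H_n is not virtually cyclic and there exist a geodesic Gromov-hyperbolic metric space X and an isometric action of H_n on X that is acylindrical and has an unbounded orbit. -/

import Mathlib

def higmanRels (n : ℕ) : Set (FreeGroup (ZMod n)) :=
  {r | ∃ i : ZMod n,
    r = FreeGroup.of i * FreeGroup.of (i + 1) * (FreeGroup.of i)⁻¹ * ((FreeGroup.of (i + 1))⁻¹) ^ 2}

abbrev HigmanGroup (n : ℕ) : Type := PresentedGroup (higmanRels n)

def IsGeodesicSpace (X : Type*) [MetricSpace X] : Prop :=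
  ∀ x y : X, ∃ γ : ℝ → X, γ 0 = x ∧ γ (dist x y) = y ∧
    ∀ s ∈ Set.Icc (0 : ℝ) (dist x y), ∀ t ∈ Set.Icc (0 : ℝ) (dist x y),
      dist (γ s) (γ t) = |s - t|

def IsGromovHyperbolic (X : Type*) [MetricSpace X] : Prop :=
  ∃ δ : ℝ, 0 ≤ δ ∧ ∀ x y z w : X,
    (dist x w + dist z w - dist x z) / 2 ≥
      min ((dist x w + dist y w - dist x y) / 2) ((dist y w + dist z w - dist y z) / 2) - δ

def IsAcylindricalAction {G X : Type*} [Group G] [MetricSpace X] (act : G → X → X) : Prop :=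
  ∀ r : ℝ, 0 ≤ r → ∃ (L : ℝ) (N : ℕ), 0 ≤ L ∧ ∀ x y : X, L ≤ dist x y →
    {g : G | dist x (act g x) ≤ r ∧ dist y (act g y) ≤ r}.Finite ∧
    {g : G | dist x (act g x) ≤ r ∧ dist y (act g y) ≤ r}.ncard ≤ N

def IsVirtuallyCyclic (G : Type*) [Group G] : Prop :=
  ∃ H : Subgroup G, IsCyclic H ∧ H.FiniteIndex

def GoodAcylAction (G : Type*) [Group G] (X : Type*) [MetricSpace X] (act : G → X → X) : Prop :=
  (∀ g : G, Isometry (act g)) ∧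
  (∀ x : X, act 1 x = x) ∧
  (∀ (g h : G) (x : X), act (g * h) x = act g (act h x)) ∧
  IsGeodesicSpace X ∧ IsGromovHyperbolic X ∧ IsAcylindricalAction act ∧
  ∃ x : X, ¬ Bornology.IsBounded (Set.range fun g : G => act g x)

def IsAcylindricallyHyperbolic (G : Type*) [Group G] : Prop :=
  ¬ IsVirtuallyCyclic G ∧
  ∃ (X : Type) (m : MetricSpace X) (act : G → X → X), @GoodAcylAction G _ X m act

/-- A pseudometric satisfying the four point condition of trees. -/
class IsTreeMetric {V : Type} (D : V → V → ℝ) : Prop where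
  self (x : V) : D x x = 0
  symm (x y : V) : D x y = D y x
  four_point (x y z w : V) : D x y + D z w ≤ max (D x z + D y w) (D x w + D y z)

namespace IsTreeMetric

variable {V : Type} {D : V → V → ℝ} [IsTreeMetric D]

theorem triangle (x y z : V) : D x z ≤ D x y + D y z := by
  have h := four_point (D := D) x z y y
  rw [self (D := D), symm (D := D) z y] at h
  simpa using h

theorem nonneg (x y : V) : 0 ≤ D x y := by
  have h := triangle (D := D) x y x
  rw [self (D := D), symm (D := D) y x] at h
  linarith

end IsTreeMetric

/-- The distance function to the point at distance `s` from `x` on the segment from `x` to `y`. -/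
noncomputable def segPoint {V : Type} (D : V → V → ℝ) (x y : V) (s : ℝ) (w : V) : ℝ :=
  max (D x w - s) (D y w - (D x y - s))

/-- The union of all segments spanned by a tree metric, as functions on the underlying set. -/
structure TreeSpan {V : Type} (D : V → V → ℝ) : Type where
  /-- The distance function to the point. -/
  toFun : V → ℝ
  exists_eq_segPoint : ∃ x y s, 0 ≤ s ∧ s ≤ D x y ∧ toFun = segPoint D x y s

namespace TreeSpan

open IsTreeMetric

variable {V : Type} {D : V → V → ℝ}

instance : CoeFun (TreeSpan D) fun _ => V → ℝ := ⟨toFun⟩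

theorem ext {p q : TreeSpan D} (h : ∀ w, p w = q w) : p = q := by
  cases p
  cases q
  congr
  exact funext h

variable [IsTreeMetric D]

theorem le_add (p : TreeSpan D) (u v : V) : D u v ≤ p u + p v := by
  obtain ⟨f, x, y, s, -, -, rfl⟩ := p
  have h := four_point (D := D) u v x y
  rw [symm (D := D) u x, symm (D := D) v y, symm (D := D) u y, symm (D := D) v x] at h
  simp only [segPoint]
  rcases le_max_iff.1 h with h | h
  · have h1 := le_max_left (D x u - s) (D y u - (D x y - s))
    have h2 := le_max_right (D x v - s) (D y v - (D x y - s))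
    linarith
  · have h1 := le_max_right (D x u - s) (D y u - (D x y - s))
    have h2 := le_max_left (D x v - s) (D y v - (D x y - s))
    linarith

theorem le_dist_add (p : TreeSpan D) (u v : V) : p u ≤ D u v + p v := by
  obtain ⟨f, x, y, s, -, -, rfl⟩ := p
  have h1 := le_max_left (D x v - s) (D y v - (D x y - s))
  have h2 := le_max_right (D x v - s) (D y v - (D x y - s))
  have h3 := triangle (D := D) x v u
  have h4 := triangle (D := D) y v u
  rw [symm (D := D) v u] at h3 h4
  exact max_le (by simp only [segPoint]; linarith) (by simp only [segPoint]; linarith)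

theorem four_point (p : TreeSpan D) (u v w : V) :
    p u + D v w ≤ max (p v + D u w) (p w + D u v) := by
  obtain ⟨f, x, y, s, -, -, rfl⟩ := p
  have key : ∀ z c, (∀ w, D z w - c ≤ segPoint D x y s w) →
      D z u - c + D v w ≤ max (segPoint D x y s v + D u w) (segPoint D x y s w + D u v) := by
    intro z c hz
    rw [le_max_iff]
    rcases le_max_iff.1 (IsTreeMetric.four_point (D := D) z u v w) with h | h
    · left; linarith [hz v]
    · right; linarith [hz w]
  have h1 := key x s fun w => le_max_left _ _
  have h2 := key y (D x y - s) fun w => le_max_right _ _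
  change max (D x u - s) (D y u - (D x y - s)) + D v w ≤ _
  rw [max_add]
  exact max_le h1 h2

theorem nonneg (p : TreeSpan D) (u : V) : 0 ≤ p u := by
  have := p.le_add u u
  rw [self (D := D)] at this
  linarith

theorem exists_ends (p : TreeSpan D) : ∃ x y, p x + p y = D x y := by
  obtain ⟨f, x, y, s, h0, h1, rfl⟩ := p
  refine ⟨x, y, ?_⟩
  simp only [segPoint, self, symm (D := D) y x]
  rw [max_eq_right (by linarith), max_eq_left (by linarith)]
  ring

theorem eq_max (p : TreeSpan D) {x y : V} (h : p x + p y = D x y) (w : V) :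
    p w = max (D x w - p x) (D y w - p y) := by
  apply le_antisymm
  · have h1 := p.four_point w x y
    rw [symm (D := D) w y, symm (D := D) w x] at h1
    rw [le_max_iff]
    rcases le_max_iff.1 h1 with h1 | h1
    · right; linarith
    · left; linarith
  · refine max_le ?_ ?_
    · linarith [p.le_add x w]
    · linarith [p.le_add y w]

theorem abs_sub_le_add (p q : TreeSpan D) (x w : V) : |p w - q w| ≤ p x + q x := by
  have h1 := p.le_dist_add w x
  have h2 := q.le_dist_add w x
  have h3 := p.le_add w x
  have h4 := q.le_add w x
  rw [abs_le]
  constructor <;> linarith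

theorem bddAbove (p q : TreeSpan D) : BddAbove (Set.range fun w => |p w - q w|) := by
  obtain ⟨x, -⟩ := p.exists_ends
  exact ⟨p x + q x, by rintro _ ⟨w, rfl⟩; exact abs_sub_le_add p q x w⟩

noncomputable instance : MetricSpace (TreeSpan D) where
  dist p q := ⨆ w, |p w - q w|
  dist_self p := by simp
  dist_comm p q := by simp only [abs_sub_comm]
  dist_triangle p q r := by
    obtain ⟨x, -⟩ := p.exists_ends
    have : Nonempty V := ⟨x⟩
    refine ciSup_le fun w => (abs_sub_le _ (q w) _).trans ?_
    exact add_le_add (le_ciSup (bddAbove p q) w) (le_ciSup (bddAbove q r) w)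
  eq_of_dist_eq_zero {p q} h := by
    refine ext fun w => ?_
    have h1 : |p w - q w| ≤ 0 := (le_ciSup (bddAbove p q) w).trans h.le
    linarith [abs_nonpos_iff.1 h1]

theorem dist_def (p q : TreeSpan D) : dist p q = ⨆ w, |p w - q w| := rfl

theorem abs_sub_le_dist (p q : TreeSpan D) (w : V) : |p w - q w| ≤ dist p q :=
  le_ciSup (bddAbove p q) w

theorem dist_le {p q : TreeSpan D} {C : ℝ} (h : ∀ w, |p w - q w| ≤ C) : dist p q ≤ C := by
  obtain ⟨x, -⟩ := p.exists_ends
  have : Nonempty V := ⟨x⟩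
  exact ciSup_le h

/-- Any two points lie on a common segment. -/
theorem exists_common_ends (p q : TreeSpan D) :
    ∃ a b, p a + p b = D a b ∧ q a + q b = D a b := by
  obtain ⟨x, y, hxy⟩ := p.exists_ends
  obtain ⟨z, w, hzw⟩ := q.exists_ends
  obtain ⟨a, ha, b, hb, h⟩ : ∃ a, (a = x ∨ a = y) ∧ ∃ b, (b = z ∨ b = w) ∧
      ∀ a', (a' = x ∨ a' = y) → ∀ b', (b' = z ∨ b' = w) →
        D a' b' - p a' - q b' ≤ D a b - p a - q b := by
    obtain ⟨m, hm, h⟩ := ((({x, y} : Set V) ×ˢ ({z, w} : Set V)).toFinite).exists_maximalFor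
      (fun m => D m.1 m.2 - p m.1 - q m.2) _ ⟨(x, z), by simp⟩
    refine ⟨m.1, by simpa using hm.1, m.2, by simpa using hm.2, fun a' ha' b' hb' => ?_⟩
    have := h (j := (a', b')) ⟨by simpa using ha', by simpa using hb'⟩
    rcases le_total (D a' b' - p a' - q b') (D m.1 m.2 - p m.1 - q m.2) with h1 | h1
    · exact h1
    · exact this h1
  refine ⟨a, b, ?_, ?_⟩
  · have hp := p.eq_max hxy b
    have h1 := h x (Or.inl rfl) b hb
    have h2 := h y (Or.inr rfl) b hb
    have : p b ≤ D a b - p a := by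
      rw [hp]
      exact max_le (by linarith) (by linarith)
    linarith [p.le_add a b]
  · have hq := q.eq_max hzw a
    have h1 := h a ha z (Or.inl rfl)
    have h2 := h a ha w (Or.inr rfl)
    rw [symm (D := D) a z] at h1
    rw [symm (D := D) a w] at h2
    have : q a ≤ D a b - q b := by
      rw [hq]
      exact max_le (by linarith) (by linarith)
    linarith [q.le_add a b]

/-- The point at distance `s` from `a` on the segment from `a` to `b`. -/
noncomputable def seg (D : V → V → ℝ) (a b : V) (s : ℝ) (h0 : 0 ≤ s) (h1 : s ≤ D a b) :
    TreeSpan D :=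
  ⟨segPoint D a b s, a, b, s, h0, h1, rfl⟩

theorem dist_seg (a b : V) {s t : ℝ} (h0 : 0 ≤ s) (h1 : s ≤ D a b) (h0' : 0 ≤ t)
    (h1' : t ≤ D a b) : dist (seg D a b s h0 h1) (seg D a b t h0' h1') = |s - t| := by
  apply le_antisymm
  · refine dist_le fun w => ?_
    refine (abs_max_sub_max_le_max _ _ _ _).trans (max_le ?_ ?_)
    · rw [abs_sub_comm s t]; apply le_of_eq; congr 1; ring
    · apply le_of_eq; congr 1; ring
  · have := abs_sub_le_dist (seg D a b s h0 h1) (seg D a b t h0' h1') a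
    simp only [seg, segPoint, self, symm (D := D) b a] at this
    rwa [max_eq_right (by linarith), max_eq_right (by linarith), sub_sub_cancel, sub_sub_cancel]
      at this

theorem eq_seg (p : TreeSpan D) {a b : V} (h : p a + p b = D a b) :
    p = seg D a b (p a) (p.nonneg a) (by linarith [p.nonneg b]) := by
  refine ext fun w => ?_
  rw [p.eq_max h]
  simp only [seg, segPoint, ← h]
  congr 2
  ring

theorem isGeodesicSpace : IsGeodesicSpace (TreeSpan D) := by
  suffices H : ∀ p q : TreeSpan D, ∀ a b, p a + p b = D a b → q a + q b = D a b → p a ≤ q a →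
      ∃ γ : ℝ → TreeSpan D, γ 0 = p ∧ γ (dist p q) = q ∧
      ∀ s ∈ Set.Icc (0 : ℝ) (dist p q), ∀ t ∈ Set.Icc (0 : ℝ) (dist p q),
        dist (γ s) (γ t) = |s - t| by
    intro p q
    obtain ⟨a, b, hp, hq⟩ := exists_common_ends p q
    rcases le_total (p a) (q a) with h | h
    · exact H p q a b hp hq h
    · refine H p q b a ?_ ?_ (by linarith) <;> rw [symm (D := D) b a] <;> linarith
  intro p q a b hp hq hpq
  have h0 (s : ℝ) : 0 ≤ min (max (p a + s) 0) (D a b) :=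
    le_min (le_max_right _ _) (IsTreeMetric.nonneg _ _)
  have hd : dist p q = q a - p a := by
    rw [p.eq_seg hp, q.eq_seg hq, dist_seg, ← p.eq_seg hp, ← q.eq_seg hq, abs_sub_comm,
      abs_of_nonneg (by linarith)]
  have hp0 := p.nonneg a
  have hq0 := q.nonneg b
  refine ⟨fun s => seg D a b (min (max (p a + s) 0) (D a b)) (h0 s) (min_le_right _ _),
    ?_, ?_, ?_⟩
  · conv_rhs => rw [p.eq_seg hp]
    dsimp only
    congr 1
    rw [max_eq_left (by linarith), min_eq_left (by linarith), add_zero]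
  · conv_rhs => rw [q.eq_seg hq]
    dsimp only
    congr 1
    rw [hd, max_eq_left (by linarith), min_eq_left (by linarith)]
    ring
  · intro s hs t ht
    rw [hd] at hs ht
    obtain ⟨hs0, hs1⟩ := hs
    obtain ⟨ht0, ht1⟩ := ht
    rw [dist_seg, max_eq_left (by linarith), min_eq_left (by linarith), max_eq_left (by linarith),
      min_eq_left (by linarith)]
    congr 1
    ring

/-- The canonical map from the underlying set to the tree. -/
noncomputable def vertex (D : V → V → ℝ) [IsTreeMetric D] (v : V) : TreeSpan D :=
  ⟨fun w => D v w, v, v, 0, le_rfl, (self v).ge, by ext w; simp [segPoint, self]⟩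

theorem dist_vertex (u v : V) : dist (vertex D u) (vertex D v) = D u v := by
  apply le_antisymm
  · refine dist_le fun w => ?_
    have h1 := triangle (D := D) u v w
    have h2 := triangle (D := D) v u w
    rw [symm (D := D) v u] at h2
    simp only [vertex]
    rw [abs_le]
    constructor <;> linarith
  · have := abs_sub_le_dist (vertex D u) (vertex D v) v
    simp only [vertex, self, sub_zero] at this
    exact (le_abs_self _).trans this

theorem isGromovHyperbolic_of_dist_vertex_le
    (h : ∀ p : TreeSpan D, ∃ v, dist p (vertex D v) ≤ 1) : IsGromovHyperbolic (TreeSpan D) := by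
  refine ⟨6, by norm_num, fun x y z w => ?_⟩
  have key (p q : TreeSpan D) (u v : V) (hu : dist p (vertex D u) ≤ 1)
      (hv : dist q (vertex D v) ≤ 1) : |dist p q - D u v| ≤ 2 := by
    rw [← dist_vertex (D := D) u v]
    have h1 := dist_triangle4 p (vertex D u) (vertex D v) q
    have h2 := dist_triangle4 (vertex D u) p q (vertex D v)
    rw [dist_comm (vertex D v) q] at h1
    rw [dist_comm (vertex D u) p] at h2
    rw [abs_le]
    constructor <;> linarith
  obtain ⟨x', hx⟩ := h x
  obtain ⟨y', hy⟩ := h y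
  obtain ⟨z', hz⟩ := h z
  obtain ⟨w', hw⟩ := h w
  have h1 := abs_le.1 (key x w x' w' hx hw)
  have h2 := abs_le.1 (key y w y' w' hy hw)
  have h3 := abs_le.1 (key z w z' w' hz hw)
  have h4 := abs_le.1 (key x z x' z' hx hz)
  have h5 := abs_le.1 (key x y x' y' hx hy)
  have h6 := abs_le.1 (key y z y' z' hy hz)
  have h7 := IsTreeMetric.four_point (D := D) x' z' y' w'
  rw [symm (D := D) z' y'] at h7
  rw [ge_iff_le, sub_le_iff_le_add, min_le_iff]
  rcases le_max_iff.1 h7 with h7 | h7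
  · left; linarith
  · right; linarith

end TreeSpan

/-- A length function on a group for which the group acts on the associated tree so that stabilisers
of three consecutive points are trivial. -/
class IsAcylindricalTreeLength {G : Type} [Group G] (ℓ : G → ℕ) : Prop where
  one : ℓ 1 = 0
  inv (g : G) : ℓ g⁻¹ = ℓ g
  four_point (x y z : G) :
    ℓ (x⁻¹ * y) + ℓ z ≤ max (ℓ x + ℓ (y⁻¹ * z)) (ℓ y + ℓ (x⁻¹ * z))
  exists_prefix (g : G) (k : ℕ) (hk : k ≤ ℓ g) : ∃ p, ℓ p = k ∧ ℓ p + ℓ (p⁻¹ * g) = ℓ g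
  eq_one (a b c : G) (ha : ℓ a = 1) (hb : ℓ b = 1) (hab : ℓ (a * b) = 2) (hc : ℓ c = 0)
    (hac : ℓ (a * c * a⁻¹) = 0) (hbc : ℓ (b⁻¹ * c * b) = 0) : c = 1
  unbounded (N : ℕ) : ∃ g, N ≤ ℓ g

namespace IsAcylindricalTreeLength

variable {G : Type} [Group G] {ℓ : G → ℕ}

theorem four_point' [IsAcylindricalTreeLength ℓ] (x y z w : G) :
    ℓ (x⁻¹ * y) + ℓ (z⁻¹ * w) ≤
      max (ℓ (x⁻¹ * z) + ℓ (y⁻¹ * w)) (ℓ (x⁻¹ * w) + ℓ (y⁻¹ * z)) := by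
  have h := four_point (ℓ := ℓ) (z⁻¹ * x) (z⁻¹ * y) (z⁻¹ * w)
  simp only [mul_inv_rev, inv_inv, mul_assoc, mul_inv_cancel_left] at h
  rw [← inv (ℓ := ℓ) (z⁻¹ * x), ← inv (ℓ := ℓ) (z⁻¹ * y)] at h
  simp only [mul_inv_rev, inv_inv] at h
  rwa [add_comm (ℓ (y⁻¹ * z))] at h

theorem symm [IsAcylindricalTreeLength ℓ] (x y : G) : ℓ (x⁻¹ * y) = ℓ (y⁻¹ * x) := by
  rw [← inv (ℓ := ℓ) (x⁻¹ * y)]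
  simp

theorem between_of_between [IsAcylindricalTreeLength ℓ] {x y x' y' p : G} {r : ℕ}
    (hp : ℓ (x'⁻¹ * p) + ℓ (p⁻¹ * y') = ℓ (x'⁻¹ * y')) (hxy : ℓ (x⁻¹ * y) = ℓ (x'⁻¹ * y'))
    (hx : ℓ (x⁻¹ * x') ≤ r) (hy : ℓ (y⁻¹ * y') ≤ r) (hxp : r < ℓ (x'⁻¹ * p))
    (hyp : r < ℓ (p⁻¹ * y')) : ℓ (x⁻¹ * p) + ℓ (p⁻¹ * y) = ℓ (x⁻¹ * y) := by
  have h1 := four_point' (ℓ := ℓ) x' y' x p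
  have h2 := four_point' (ℓ := ℓ) x y' p y
  have h3 := four_point' (ℓ := ℓ) x y p p
  rw [inv_mul_cancel, one (ℓ := ℓ)] at h3
  rw [symm (ℓ := ℓ) x' x, symm (ℓ := ℓ) y' p, symm (ℓ := ℓ) y' x] at h1
  rw [symm (ℓ := ℓ) y' y, symm (ℓ := ℓ) y' p] at h2
  rw [symm (ℓ := ℓ) y p] at h3
  omega

theorem eq_zero_of_between [IsAcylindricalTreeLength ℓ] {x y p q : G}
    (hp : ℓ (x⁻¹ * p) + ℓ (p⁻¹ * y) = ℓ (x⁻¹ * y)) (hq : ℓ (x⁻¹ * q) + ℓ (q⁻¹ * y) = ℓ (x⁻¹ * y))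
    (hpq : ℓ (x⁻¹ * p) = ℓ (x⁻¹ * q)) : ℓ (p⁻¹ * q) = 0 := by
  have h1 := four_point' (ℓ := ℓ) x y p q
  rw [symm (ℓ := ℓ) y p, symm (ℓ := ℓ) y q] at h1
  omega

theorem triangle [IsAcylindricalTreeLength ℓ] (x y z : G) :
    ℓ (x⁻¹ * z) ≤ ℓ (x⁻¹ * y) + ℓ (y⁻¹ * z) := by
  have h := four_point' (ℓ := ℓ) x z y y
  rw [inv_mul_cancel, one (ℓ := ℓ), symm (ℓ := ℓ) z y] at h
  omega

theorem exists_consecutive [IsAcylindricalTreeLength ℓ] (x y : G) (k : ℕ)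
    (hk : k + 2 ≤ ℓ (x⁻¹ * y)) : ∃ p : ℕ → G,
      (∀ i ≤ 2, ℓ (x⁻¹ * p i) = k + i ∧ ℓ (x⁻¹ * p i) + ℓ ((p i)⁻¹ * y) = ℓ (x⁻¹ * y)) ∧
      ℓ ((p 0)⁻¹ * p 1) = 1 ∧ ℓ ((p 1)⁻¹ * p 2) = 1 ∧ ℓ ((p 0)⁻¹ * p 2) = 2 := by
  have key (y : G) (k : ℕ) (hk : k ≤ ℓ (x⁻¹ * y)) :
      ∃ p, ℓ (x⁻¹ * p) = k ∧ ℓ (x⁻¹ * p) + ℓ (p⁻¹ * y) = ℓ (x⁻¹ * y) := by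
    obtain ⟨p, h1, h2⟩ := exists_prefix (ℓ := ℓ) (x⁻¹ * y) k hk
    exact ⟨x * p, by simpa using h1, by simpa [mul_assoc] using h2⟩
  obtain ⟨c, hc, hc'⟩ := key y (k + 2) hk
  obtain ⟨b, hb, hb'⟩ := key c (k + 1) (by omega)
  obtain ⟨a, ha, ha'⟩ := key b k (by omega)
  have h1 := triangle (ℓ := ℓ) b c y
  have h2 := triangle (ℓ := ℓ) a b y
  have h3 := triangle (ℓ := ℓ) x b y
  have h4 := triangle (ℓ := ℓ) x a y
  have h5 := triangle (ℓ := ℓ) x a c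
  have h6 := triangle (ℓ := ℓ) a b c
  refine ⟨fun i => if i = 0 then a else if i = 1 then b else c, ?_, ?_⟩
  · intro i hi
    interval_cases i <;> simp <;> omega
  · simp
    omega

/-- The set of elements moving two points by at most `r`. -/
def coarseStabilizer (ℓ : G → ℕ) (r : ℕ) (x y : G) : Set G :=
  {g | ℓ (x⁻¹ * (g * x)) ≤ r ∧ ℓ (y⁻¹ * (g * y)) ≤ r}

theorem coarseStabilizer_small [IsAcylindricalTreeLength ℓ] (r : ℕ) (x y : G)
    (h : 2 * r + 4 ≤ ℓ (x⁻¹ * y)) :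
    (coarseStabilizer ℓ r x y).Finite ∧
      (coarseStabilizer ℓ r x y).ncard ≤ (2 * r + 4) * ((2 * r + 4) * (2 * r + 4)) := by
  obtain ⟨p, hp, h01, h12, h02⟩ := exists_consecutive (ℓ := ℓ) x y (r + 1) (by omega)
  let T : Finset (ℕ × ℕ × ℕ) :=
    Finset.range (2 * r + 4) ×ˢ (Finset.range (2 * r + 4) ×ˢ Finset.range (2 * r + 4))
  let F : G → ℕ × ℕ × ℕ := fun g =>
    (ℓ (x⁻¹ * (g * p 0)), ℓ (x⁻¹ * (g * p 1)), ℓ (x⁻¹ * (g * p 2)))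
  have inv_mul (g u v : G) : (g * u)⁻¹ * (g * v) = u⁻¹ * v := by group
  have hmem : ∀ g ∈ coarseStabilizer ℓ r x y, ∀ i ≤ 2, ℓ (x⁻¹ * (g * p i)) < 2 * r + 4 ∧
      ℓ (x⁻¹ * (g * p i)) + ℓ ((g * p i)⁻¹ * y) = ℓ (x⁻¹ * y) := by
    rintro g ⟨hgx, hgy⟩ i hi
    obtain ⟨h1, h2⟩ := hp i hi
    constructor
    · have h3 := triangle (ℓ := ℓ) x (g * x) (g * p i)
      rw [inv_mul] at h3
      omega
    · refine between_of_between (x' := g * x) (y' := g * y) (r := r) ?_ ?_ hgx hgy ?_ ?_ <;>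
        simp only [inv_mul] <;> omega
  have hF : Set.MapsTo F (coarseStabilizer ℓ r x y) T := by
    intro g hg
    simp only [F, T, Finset.coe_product, Set.mem_prod, Finset.mem_coe, Finset.mem_range]
    exact ⟨(hmem g hg 0 (by omega)).1, (hmem g hg 1 (by omega)).1, (hmem g hg 2 le_rfl).1⟩
  have hinj : Set.InjOn F (coarseStabilizer ℓ r x y) := by
    intro g hg g' hg' hgg
    simp only [F, Prod.mk.injEq] at hgg
    obtain ⟨e0, e1, e2⟩ := hgg
    have z0 := eq_zero_of_between (hmem g hg 0 (by omega)).2 (hmem g' hg' 0 (by omega)).2 e0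
    have z1 := eq_zero_of_between (hmem g hg 1 (by omega)).2 (hmem g' hg' 1 (by omega)).2 e1
    have z2 := eq_zero_of_between (hmem g hg 2 le_rfl).2 (hmem g' hg' 2 le_rfl).2 e2
    have := eq_one (ℓ := ℓ) ((p 0)⁻¹ * p 1) ((p 1)⁻¹ * p 2) ((g * p 1)⁻¹ * (g' * p 1)) h01 h12
      (by simpa [mul_assoc] using h02) z1 (by simpa [mul_assoc] using z0)
      (by simpa [mul_assoc] using z2)
    rw [inv_mul_eq_one] at this
    exact mul_right_cancel this
  refine ⟨Set.Finite.of_injOn hF hinj T.finite_toSet, ?_⟩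
  refine (Set.ncard_le_ncard_of_injOn F hF hinj T.finite_toSet).trans ?_
  rw [Set.ncard_coe_finset]
  simp [T]

/-- The left invariant metric of a length function. -/
def lengthDist (ℓ : G → ℕ) (g h : G) : ℝ := ℓ (g⁻¹ * h)

instance [IsAcylindricalTreeLength ℓ] : IsTreeMetric (lengthDist ℓ) where
  self x := by simp [lengthDist, one]
  symm x y := by simp only [lengthDist, symm x y]
  four_point x y z w := by
    have := four_point' (ℓ := ℓ) x y z w
    simp only [lengthDist]
    exact_mod_cast this

theorem lengthDist_mul_left (g x y : G) : lengthDist ℓ (g * x) (g * y) = lengthDist ℓ x y := by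
  simp only [lengthDist]
  congr 2
  group

/-- The action on the tree. -/
noncomputable def act (g : G) (p : TreeSpan (lengthDist ℓ)) : TreeSpan (lengthDist ℓ) where
  toFun w := p (g⁻¹ * w)
  exists_eq_segPoint := by
    obtain ⟨x, y, s, h0, h1, h⟩ := p.exists_eq_segPoint
    refine ⟨g * x, g * y, s, h0, by rwa [lengthDist_mul_left], ?_⟩
    ext w
    have h2 (x : G) : lengthDist ℓ (g * x) w = lengthDist ℓ x (g⁻¹ * w) := by
      rw [← lengthDist_mul_left g x, mul_inv_cancel_left]
    rw [h]
    simp only [segPoint, lengthDist_mul_left, h2]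

variable [IsAcylindricalTreeLength ℓ]

theorem act_vertex (g x : G) :
    act g (TreeSpan.vertex (lengthDist ℓ) x) = TreeSpan.vertex (lengthDist ℓ) (g * x) := by
  refine TreeSpan.ext fun w => ?_
  change lengthDist ℓ x (g⁻¹ * w) = lengthDist ℓ (g * x) w
  rw [← lengthDist_mul_left g x, mul_inv_cancel_left]

theorem isometry_act (g : G) :
    Isometry (act g : TreeSpan (lengthDist ℓ) → TreeSpan (lengthDist ℓ)) := by
  refine Isometry.of_dist_eq fun p q => ?_
  rw [TreeSpan.dist_def, TreeSpan.dist_def]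
  exact (Equiv.mulLeft g⁻¹).iSup_congr fun w => rfl

theorem exists_dist_vertex_le (p : TreeSpan (lengthDist ℓ)) :
    ∃ v, dist p (TreeSpan.vertex (lengthDist ℓ) v) ≤ 1 := by
  obtain ⟨x, y, h⟩ := p.exists_ends
  have hx := p.nonneg x
  have hy := p.nonneg y
  have hk : ⌊p x⌋₊ ≤ ℓ (x⁻¹ * y) := by
    have : (⌊p x⌋₊ : ℝ) ≤ lengthDist ℓ x y := (Nat.floor_le hx).trans (by linarith)
    rw [lengthDist] at this
    exact_mod_cast this
  obtain ⟨v, hv, hv'⟩ := exists_prefix (ℓ := ℓ) (x⁻¹ * y) _ hk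
  have h1 : TreeSpan.vertex (lengthDist ℓ) (x * v) x = ⌊p x⌋₊ := by
    change ((ℓ ((x * v)⁻¹ * x) : ℕ) : ℝ) = _
    rw [← symm (ℓ := ℓ)]
    simp [hv]
  have h2 : TreeSpan.vertex (lengthDist ℓ) (x * v) x + TreeSpan.vertex (lengthDist ℓ) (x * v) y =
      lengthDist ℓ x y := by
    change ((ℓ ((x * v)⁻¹ * x) : ℕ) : ℝ) + ((ℓ ((x * v)⁻¹ * y) : ℕ) : ℝ) = (ℓ (x⁻¹ * y) : ℕ)
    rw [← symm (ℓ := ℓ)]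
    simp only [inv_mul_cancel_left, mul_inv_rev, mul_assoc]
    exact_mod_cast hv'
  refine ⟨x * v, ?_⟩
  rw [p.eq_seg h, TreeSpan.eq_seg _ h2, TreeSpan.dist_seg, h1,
    abs_of_nonneg (by linarith [Nat.floor_le hx])]
  linarith [Nat.lt_floor_add_one (p x)]

theorem isAcylindricalAction_act :
    IsAcylindricalAction (act : G → TreeSpan (lengthDist ℓ) → TreeSpan (lengthDist ℓ)) := by
  intro r hr
  obtain ⟨R, hR⟩ := exists_nat_ge (r + 2)
  refine ⟨2 * R + 4 + 2, (2 * R + 4) * ((2 * R + 4) * (2 * R + 4)), by positivity,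
    fun p q hpq => ?_⟩
  obtain ⟨x, hx⟩ := exists_dist_vertex_le p
  obtain ⟨y, hy⟩ := exists_dist_vertex_le q
  have hxy : 2 * R + 4 ≤ ℓ (x⁻¹ * y) := by
    have h1 := dist_triangle4 p (TreeSpan.vertex _ x) (TreeSpan.vertex _ y) q
    rw [dist_comm (TreeSpan.vertex _ y) q, TreeSpan.dist_vertex] at h1
    have : (2 * R + 4 : ℝ) ≤ lengthDist ℓ x y := by linarith
    rw [lengthDist] at this
    exact_mod_cast this
  have move (p : TreeSpan (lengthDist ℓ)) (x g : G)
      (hx : dist p (TreeSpan.vertex (lengthDist ℓ) x) ≤ 1) (hg : dist p (act g p) ≤ r) :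
      ℓ (x⁻¹ * (g * x)) ≤ R := by
    have h1 := dist_triangle4 (TreeSpan.vertex _ x) p (act g p)
      (act g (TreeSpan.vertex (lengthDist ℓ) x))
    rw [(isometry_act g).dist_eq, act_vertex, TreeSpan.dist_vertex, dist_comm _ p] at h1
    have : lengthDist ℓ x (g * x) ≤ R := by linarith
    rw [lengthDist] at this
    exact_mod_cast this
  have hsub : {g : G | dist p (act g p) ≤ r ∧ dist q (act g q) ≤ r} ⊆ coarseStabilizer ℓ R x y :=
    fun g hg => ⟨move p x g hx hg.1, move q y g hy hg.2⟩
  obtain ⟨hfin, hcard⟩ := coarseStabilizer_small R x y hxy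
  exact ⟨hfin.subset hsub, (Set.ncard_le_ncard hsub hfin).trans hcard⟩

theorem goodAcylAction_act : GoodAcylAction G (TreeSpan (lengthDist ℓ)) act := by
  refine ⟨isometry_act, fun p => ?_, fun g h p => ?_, TreeSpan.isGeodesicSpace,
    TreeSpan.isGromovHyperbolic_of_dist_vertex_le exists_dist_vertex_le,
    isAcylindricalAction_act, TreeSpan.vertex _ 1, fun hb => ?_⟩
  · refine TreeSpan.ext fun w => ?_
    change p (1⁻¹ * w) = p w
    simp
  · refine TreeSpan.ext fun w => ?_
    change p ((g * h)⁻¹ * w) = p (h⁻¹ * (g⁻¹ * w))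
    rw [mul_inv_rev, mul_assoc]
  · obtain ⟨C, hC⟩ := Metric.isBounded_iff.1 hb
    obtain ⟨N, hN⟩ := exists_nat_gt C
    obtain ⟨g, hg⟩ := unbounded (ℓ := ℓ) N
    have h1 := hC ⟨1, rfl⟩ ⟨g, rfl⟩
    simp only [act_vertex, mul_one, TreeSpan.dist_vertex, lengthDist, inv_one, one_mul] at h1
    have : (N : ℝ) ≤ ℓ g := by exact_mod_cast hg
    linarith

end IsAcylindricalTreeLength

namespace Amalgam

open Monoid PushoutI

variable {ι : Type} {G : ι → Type}

open Classical in
/-- Twice the length of the common prefix of two lists, plus one if the next letters are in the same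
factor. -/
noncomputable def overlap : List (Σ i, G i) → List (Σ i, G i) → ℕ
  | a :: l, b :: m => if a = b then 2 + overlap l m else if a.1 = b.1 then 1 else 0
  | _, _ => 0

theorem min_overlap_le (l m n : List (Σ i, G i)) :
    min (overlap l m) (overlap m n) ≤ overlap l n := by
  induction l generalizing m n with
  | nil => simp [overlap]
  | cons a l ih =>
    rcases m with _ | ⟨b, m⟩
    · simp [overlap]
    rcases n with _ | ⟨c, n⟩
    · simp [overlap]
    have := ih m n
    simp only [overlap]
    by_cases h1 : a = b
    · subst h1
      by_cases h2 : a = c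
      · subst h2
        simp only [if_true]
        omega
      · simp only [if_true, if_neg h2]
        omega
    · by_cases h2 : b = c
      · subst h2
        simp only [if_true, if_neg h1]
        omega
      · simp only [if_neg h1, if_neg h2]
        grind

variable [∀ i, Group (G i)] {H : Type} [Group H] (φ : ∀ i, H →* G i)

/-- The product in the amalgamated product of a list of elements of the factors. -/
def listProd (l : List (Σ i, G i)) : PushoutI φ := (l.map fun a => of a.1 a.2).prod

/-- Consecutive letters lie in different factors, and no letter lies in the base group. -/
structure IsReduced (l : List (Σ i, G i)) : Prop where
  chain : l.IsChain fun a b => a.1 ≠ b.1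
  notMem : ∀ a ∈ l, a.2 ∉ (φ a.1).range

variable {φ}

@[simp]
theorem listProd_nil : listProd φ [] = 1 := rfl

@[simp]
theorem listProd_cons (a : Σ i, G i) (l : List (Σ i, G i)) :
    listProd φ (a :: l) = of a.1 a.2 * listProd φ l := by
  simp [listProd]

@[simp]
theorem listProd_append (l m : List (Σ i, G i)) :
    listProd φ (l ++ m) = listProd φ l * listProd φ m := by
  simp [listProd]

theorem listProd_map_inv (l : List (Σ i, G i)) :
    listProd φ (l.map fun a => ⟨a.1, a.2⁻¹⟩) = (listProd φ l.reverse)⁻¹ := by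
  induction l with
  | nil => simp
  | cons a l ih => simp [ih]

theorem IsReduced.nil : IsReduced φ [] := ⟨List.isChain_nil, by simp⟩

theorem IsReduced.reverse {l : List (Σ i, G i)} (hl : IsReduced φ l) : IsReduced φ l.reverse where
  chain := List.isChain_reverse.2 (hl.chain.imp fun _ _ h => h.symm)
  notMem a ha := hl.notMem a (List.mem_reverse.1 ha)

theorem IsReduced.map_inv {l : List (Σ i, G i)} (hl : IsReduced φ l) :
    IsReduced φ (l.map fun a => ⟨a.1, a.2⁻¹⟩) where
  chain := (List.isChain_map _).2 hl.chain
  notMem a ha := by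
    obtain ⟨b, hb, rfl⟩ := List.mem_map.1 ha
    simpa using hl.notMem b hb

theorem IsReduced.tail {a : Σ i, G i} {l : List (Σ i, G i)} (hl : IsReduced φ (a :: l)) :
    IsReduced φ l where
  chain := hl.chain.tail
  notMem b hb := hl.notMem b (List.mem_cons_of_mem _ hb)

theorem IsReduced.append {l m : List (Σ i, G i)} (hl : IsReduced φ l) (hm : IsReduced φ m)
    (h : ∀ a ∈ l.getLast?, ∀ b ∈ m.head?, a.1 ≠ b.1) : IsReduced φ (l ++ m) where
  chain := List.isChain_append.2 ⟨hl.chain, hm.chain, h⟩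
  notMem a ha := (List.mem_append.1 ha).elim (hl.notMem a) (hm.notMem a)

theorem IsReduced.of_append {l m : List (Σ i, G i)} (h : IsReduced φ (l ++ m)) :
    IsReduced φ l ∧ IsReduced φ m := by
  obtain ⟨h1, h2, -⟩ := List.isChain_append.1 h.chain
  exact ⟨⟨h1, fun a ha => h.notMem a (List.mem_append_left _ ha)⟩,
    ⟨h2, fun a ha => h.notMem a (List.mem_append_right _ ha)⟩⟩

theorem IsReduced.exists_normalWord (d : NormalWord.Transversal φ) {l : List (Σ i, G i)}
    (hl : IsReduced φ l) : ∃ w : NormalWord d, w.prod = listProd φ l ∧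
      w.toList.length = l.length := by
  obtain ⟨w, hw, hw'⟩ := Reduced.exists_normalWord_prod_eq d (w := ⟨l, fun a ha h => hl.notMem a ha
    (h ▸ one_mem _), hl.chain⟩) hl.notMem
  refine ⟨w, hw.trans ?_, by simpa using congrArg List.length hw'⟩
  simp only [CoprodI.Word.prod, map_list_prod, List.map_map, listProd]
  rfl

theorem isReduced_normalWord {d : NormalWord.Transversal φ} (w : NormalWord d) :
    IsReduced φ w.toList where
  chain := w.chain_ne
  notMem a ha hr := by
    have h1 := w.normalized a.1 a.2 ha
    refine w.ne_one a ha ?_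
    have h2 := (d.compl a.1).existsUnique a.2
    obtain ⟨y, -, hy⟩ := h2
    have e1 := hy ⟨1, ⟨a.2, h1⟩⟩ (by simp)
    have e2 := hy ⟨⟨a.2, hr⟩, ⟨1, d.one_mem _⟩⟩ (by simp)
    have := congrArg (fun p => (p.2 : G a.1)) (e1.trans e2.symm)
    simpa using this

open Classical in
/-- The normal word of an element of an amalgamated product. -/
noncomputable def normalWord (d : NormalWord.Transversal φ) (g : PushoutI φ) : NormalWord d :=
  NormalWord.equiv g

theorem normalWord_prod (d : NormalWord.Transversal φ) (w : NormalWord d) :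
    normalWord d w.prod = w := by
  classical
  exact NormalWord.equiv.apply_symm_apply w

theorem prod_normalWord (d : NormalWord.Transversal φ) (g : PushoutI φ) :
    base φ (normalWord d g).head * listProd φ (normalWord d g).toList = g := by
  classical
  have h : (normalWord d g).prod = g := NormalWord.equiv.symm_apply_apply g
  conv_rhs => rw [← h]
  simp only [NormalWord.prod, CoprodI.Word.prod, map_list_prod, List.map_map, listProd]
  rfl

/-- The length of an element of an amalgamated product. -/
noncomputable def length (d : NormalWord.Transversal φ) (g : PushoutI φ) : ℕ :=
  (normalWord d g).toList.length

variable (d : NormalWord.Transversal φ)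

theorem length_base_mul_listProd {l : List (Σ i, G i)} (hl : IsReduced φ l) (h : H) :
    length d (base φ h * listProd φ l) = l.length := by
  obtain ⟨w, hw, hw'⟩ := hl.exists_normalWord d
  rw [← hw, ← NormalWord.prod_base_smul, length, normalWord_prod, ← hw']
  rfl

theorem length_listProd {l : List (Σ i, G i)} (hl : IsReduced φ l) :
    length d (listProd φ l) = l.length := by
  simpa using length_base_mul_listProd d hl 1

theorem length_base_mul_listProd_mul_base {l : List (Σ i, G i)} (hl : IsReduced φ l) (h k : H) :
    length d (base φ h * listProd φ l * base φ k) = l.length := by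
  rcases l.eq_nil_or_concat with rfl | ⟨m, a, rfl⟩
  · simpa using length_base_mul_listProd d IsReduced.nil (h * k)
  · rw [List.concat_eq_append] at *
    have hr : IsReduced φ (m ++ [⟨a.1, a.2 * φ a.1 k⟩]) := by
      constructor
      · have := hl.chain
        rw [List.isChain_append] at this ⊢
        simpa using this
      · intro b hb
        rw [List.mem_append, List.mem_singleton] at hb
        rcases hb with hb | rfl
        · exact hl.notMem b (List.mem_append_left _ hb)
        · have := hl.notMem a (by simp)
          rwa [Subgroup.mul_mem_cancel_right _ (MonoidHom.mem_range.2 ⟨k, rfl⟩)]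
    have := length_base_mul_listProd d hr h
    simpa [mul_assoc, of_apply_eq_base] using this

theorem length_inv (g : PushoutI φ) : length d g⁻¹ = length d g := by
  have h := (isReduced_normalWord (normalWord d g)).reverse.map_inv
  conv_lhs => rw [← prod_normalWord d g]
  have h1 := length_base_mul_listProd_mul_base d h 1 (normalWord d g).head⁻¹
  rw [listProd_map_inv, List.reverse_reverse] at h1
  simpa [length] using h1

theorem mul_inv_notMem_range {i : ι} {a b : G i} (ha : a ∈ d.set i) (hb : b ∈ d.set i)
    (hab : a ≠ b) : a * b⁻¹ ∉ (φ i).range := by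
  intro hr
  obtain ⟨y, -, hy⟩ := (d.compl i).existsUnique a
  have e1 := hy ⟨1, ⟨a, ha⟩⟩ (by simp)
  have e2 := hy ⟨⟨_, hr⟩, ⟨b, hb⟩⟩ (by simp)
  exact hab (by simpa using congrArg (fun p => (p.2 : G i)) (e1.trans e2.symm))

theorem exists_isReduced_mul_inv {l m : List (Σ i, G i)} (hl : IsReduced φ l) (hm : IsReduced φ m)
    (hld : ∀ a ∈ l, a.2 ∈ d.set a.1) (hmd : ∀ a ∈ m, a.2 ∈ d.set a.1) :
    ∃ w, IsReduced φ w ∧ listProd φ w = listProd φ l.reverse * (listProd φ m.reverse)⁻¹ ∧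
      w.length + overlap l m = l.length + m.length := by
  induction l generalizing m with
  | nil => exact ⟨_, hm.map_inv, by simp [listProd_map_inv], by simp [overlap]⟩
  | cons a l ih =>
    rcases m with _ | ⟨b, m⟩
    · exact ⟨_, hl.reverse, by simp, by simp [overlap]⟩
    by_cases hab : a = b
    · subst hab
      obtain ⟨w, hw, hw1, hw2⟩ := ih hl.tail hm.tail
        (fun x hx => hld x (List.mem_cons_of_mem _ hx))
        (fun x hx => hmd x (List.mem_cons_of_mem _ hx))
      refine ⟨w, hw, by simp [hw1], ?_⟩
      simp only [overlap, if_true, List.length_cons]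
      omega
    by_cases hi : a.1 = b.1
    · obtain ⟨i, a⟩ := a
      obtain ⟨j, b⟩ := b
      obtain rfl : i = j := hi
      refine ⟨l.reverse ++ (⟨i, a * b⁻¹⟩ :: m.map fun a => ⟨a.1, a.2⁻¹⟩), ⟨?_, ?_⟩, ?_, ?_⟩
      · have h1 := hl.reverse.chain
        have h2 := hm.map_inv.chain
        rw [List.reverse_cons, List.isChain_append] at h1
        rw [List.isChain_append]
        refine ⟨h1.1, ?_, by simpa using h1.2.2⟩
        rw [List.map_cons, List.isChain_cons] at h2
        rw [List.isChain_cons]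
        simpa using h2
      · intro x hx
        rw [List.mem_append, List.mem_cons] at hx
        rcases hx with hx | rfl | hx
        · exact hl.tail.reverse.notMem x hx
        · refine mul_inv_notMem_range d (hld ⟨i, a⟩ (by simp)) (hmd ⟨i, b⟩ (by simp)) ?_
          rintro rfl
          exact hab rfl
        · exact hm.tail.map_inv.notMem x hx
      · simp [listProd_map_inv, mul_assoc]
      · simp [overlap, hab]
        omega
    · refine ⟨_, hl.reverse.append hm.map_inv ?_, ?_, ?_⟩
      · simpa using hi
      · rw [listProd_append, listProd_map_inv]
      · simp [overlap, hab, hi]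
        omega

theorem length_mul_inv (x y : PushoutI φ) :
    length d (x * y⁻¹) + overlap (normalWord d x).toList.reverse (normalWord d y).toList.reverse =
      length d x + length d y := by
  obtain ⟨w, hw, hw1, hw2⟩ := exists_isReduced_mul_inv d
    (isReduced_normalWord (normalWord d x)).reverse (isReduced_normalWord (normalWord d y)).reverse
    (fun a ha => (normalWord d x).normalized _ _ (List.mem_reverse.1 ha))
    (fun a ha => (normalWord d y).normalized _ _ (List.mem_reverse.1 ha))
  have h := length_base_mul_listProd_mul_base d hw (normalWord d x).head (normalWord d y).head⁻¹
  rw [hw1, List.reverse_reverse, List.reverse_reverse] at h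
  have e : base φ (normalWord d x).head * (listProd φ (normalWord d x).toList *
      (listProd φ (normalWord d y).toList)⁻¹) * base φ (normalWord d y).head⁻¹ = x * y⁻¹ := by
    conv_rhs => rw [← prod_normalWord d x, ← prod_normalWord d y]
    rw [map_inv]
    group
  rw [e] at h
  rw [h, hw2]
  simp [length]

theorem length_four_point (x y z : PushoutI φ) :
    length d (x⁻¹ * y) + length d z ≤
      max (length d x + length d (y⁻¹ * z)) (length d y + length d (x⁻¹ * z)) := by
  have h1 := length_mul_inv d x⁻¹ y⁻¹
  have h2 := length_mul_inv d y⁻¹ z⁻¹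
  have h3 := length_mul_inv d x⁻¹ z⁻¹
  have h4 := length_mul_inv d z⁻¹ y⁻¹
  have h5 : length d (z⁻¹ * y) = length d (y⁻¹ * z) := by
    rw [← length_inv d (z⁻¹ * y)]
    simp
  have h6 := min_overlap_le (normalWord d x⁻¹).toList.reverse (normalWord d z⁻¹).toList.reverse
    (normalWord d y⁻¹).toList.reverse
  simp only [inv_inv, length_inv] at h1 h2 h3 h4
  omega

theorem exists_eq_of_length (g : PushoutI φ) : ∃ h l, IsReduced φ l ∧ l.length = length d g ∧
    base φ h * listProd φ l = g :=
  ⟨_, _, isReduced_normalWord (normalWord d g), rfl, prod_normalWord d g⟩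

theorem exists_prefix (g : PushoutI φ) (k : ℕ) (hk : k ≤ length d g) :
    ∃ p, length d p = k ∧ length d p + length d (p⁻¹ * g) = length d g := by
  obtain ⟨h, l, hl, hlen, rfl⟩ := exists_eq_of_length d g
  rw [← hlen] at hk
  have hl' := hl
  rw [← List.take_append_drop k l] at hl'
  refine ⟨base φ h * listProd φ (l.take k), ?_⟩
  have e : (base φ h * listProd φ (l.take k))⁻¹ * (base φ h * listProd φ l) =
      listProd φ (l.drop k) := by
    conv_lhs => rw [← List.take_append_drop k l]
    rw [listProd_append, List.take_append_drop]
    group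
  rw [e, length_listProd d hl'.of_append.2, length_base_mul_listProd d hl'.of_append.1,
    length_base_mul_listProd d hl, List.length_take, List.length_drop]
  omega

theorem exists_base_eq_of_length_eq_zero {g : PushoutI φ} (hg : length d g = 0) :
    ∃ h, base φ h = g := by
  obtain ⟨h, l, -, hlen, rfl⟩ := exists_eq_of_length d g
  rw [hg, List.length_eq_zero_iff] at hlen
  exact ⟨h, by simp [hlen]⟩

theorem exists_of_eq_of_length_eq_one {g : PushoutI φ} (hg : length d g = 1) :
    ∃ i x, x ∉ (φ i).range ∧ of i x = g := by
  obtain ⟨h, l, hl, hlen, rfl⟩ := exists_eq_of_length d g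
  rw [hg, List.length_eq_one_iff] at hlen
  obtain ⟨a, rfl⟩ := hlen
  refine ⟨a.1, φ a.1 h * a.2, ?_, by simp [of_apply_eq_base]⟩
  rw [Subgroup.mul_mem_cancel_left _ (MonoidHom.mem_range.2 ⟨h, rfl⟩)]
  exact hl.notMem a (by simp)

theorem length_of_le_one (i : ι) (x : G i) : length d (of i x) ≤ 1 := by
  by_cases hx : x ∈ (φ i).range
  · obtain ⟨h, rfl⟩ := hx
    have := length_base_mul_listProd d IsReduced.nil h
    simp [of_apply_eq_base] at this ⊢
    omega
  · have := length_listProd d (l := [⟨i, x⟩]) ⟨List.isChain_singleton _, by simpa using hx⟩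
    simp at this
    omega

theorem mem_range_of_length_of_eq_zero {i : ι} {x : G i} (hx : length d (of (φ := φ) i x) = 0) :
    x ∈ (φ i).range := by
  obtain ⟨h, hh⟩ := exists_base_eq_of_length_eq_zero d hx
  rw [← of_apply_eq_base φ i] at hh
  exact ⟨h, of_injective d.injective i hh⟩

theorem eq_one_of_length
    (hφ : ∀ (i j : ι) (a : G i) (b : G j) (h : H), i ≠ j → a ∉ (φ i).range → b ∉ (φ j).range →
      a * φ i h * a⁻¹ ∈ (φ i).range → b⁻¹ * φ j h * b ∈ (φ j).range → h = 1)
    (a b c : PushoutI φ) (ha : length d a = 1) (hb : length d b = 1) (hab : length d (a * b) = 2)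
    (hc : length d c = 0) (hac : length d (a * c * a⁻¹) = 0) (hbc : length d (b⁻¹ * c * b) = 0) :
    c = 1 := by
  obtain ⟨i, a, hai, rfl⟩ := exists_of_eq_of_length_eq_one d ha
  obtain ⟨j, b, hbj, rfl⟩ := exists_of_eq_of_length_eq_one d hb
  obtain ⟨h, rfl⟩ := exists_base_eq_of_length_eq_zero d hc
  have hij : i ≠ j := by
    rintro rfl
    rw [← map_mul] at hab
    have := length_of_le_one d i (a * b)
    omega
  rw [← of_apply_eq_base φ i, ← map_mul, ← map_inv, ← map_mul] at hac
  rw [← of_apply_eq_base φ j, ← map_inv, ← map_mul, ← map_mul] at hbc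
  rw [hφ i j a b h hij hai hbj (mem_range_of_length_of_eq_zero d hac)
    (mem_range_of_length_of_eq_zero d hbc), map_one]

theorem exists_isReduced_length {G : Bool → Type} [∀ i, Group (G i)] {φ : ∀ i, H →* G i}
    (hφ : ∀ i, ∃ a, a ∉ (φ i).range) (N : ℕ) (i : Bool) :
    ∃ l, IsReduced φ l ∧ l.length = N ∧ ∀ a ∈ l.head?, a.1 = i := by
  induction N generalizing i with
  | zero => exact ⟨[], .nil, rfl, by simp⟩
  | succ N ih =>
    obtain ⟨l, hl, hN, hh⟩ := ih (!i)
    obtain ⟨a, ha⟩ := hφ i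
    refine ⟨⟨i, a⟩ :: l, ⟨List.isChain_cons.2 ⟨fun b hb => ?_, hl.chain⟩, ?_⟩, by simp [hN],
      by simp⟩
    · simp [hh b hb]
    · rintro x hx
      rcases List.mem_cons.1 hx with rfl | hx
      · exact ha
      · exact hl.notMem x hx

theorem isAcylindricalTreeLength {G : Bool → Type} [∀ i, Group (G i)] {φ : ∀ i, H →* G i}
    (d : NormalWord.Transversal φ) (hφ : ∀ i, ∃ a, a ∉ (φ i).range)
    (hφ' : ∀ (i j : Bool) (a : G i) (b : G j) (h : H), i ≠ j → a ∉ (φ i).range → b ∉ (φ j).range →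
      a * φ i h * a⁻¹ ∈ (φ i).range → b⁻¹ * φ j h * b ∈ (φ j).range → h = 1) :
    IsAcylindricalTreeLength (length d) where
  one := length_listProd d .nil
  inv := length_inv d
  four_point := length_four_point d
  exists_prefix := exists_prefix d
  eq_one := eq_one_of_length d hφ'
  unbounded N := by
    obtain ⟨l, hl, hN, -⟩ := exists_isReduced_length hφ N true
    exact ⟨_, (hN.symm.trans (length_listProd d hl).symm).le⟩

end Amalgam

namespace HNNExtension

open NormalWord

variable {L : Type} [Group L] {A B : Subgroup L} {φ : A ≃* B}

/-- The product of the syllables of a word in an HNN extension. -/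
def syllableProd (φ : A ≃* B) (l : List (ℤˣ × L)) : HNNExtension L A B φ :=
  (l.map fun x => t ^ (x.1 : ℤ) * of x.2).prod

@[simp]
theorem syllableProd_nil : syllableProd φ [] = 1 := rfl

@[simp]
theorem syllableProd_cons (x : ℤˣ × L) (l : List (ℤˣ × L)) :
    syllableProd φ (x :: l) = t ^ (x.1 : ℤ) * of x.2 * syllableProd φ l := by
  simp [syllableProd]

@[simp]
theorem syllableProd_append (l m : List (ℤˣ × L)) :
    syllableProd φ (l ++ m) = syllableProd φ l * syllableProd φ m := by
  simp [syllableProd]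

theorem prod_eq (w : ReducedWord L A B) : w.prod φ = of w.head * syllableProd φ w.toList := rfl

theorem exists_prod_eq (a : HNNExtension L A B φ) : ∃ w : ReducedWord L A B, w.prod φ = a := by
  classical
  obtain ⟨d⟩ := TransversalPair.nonempty L A B
  exact ⟨(equiv φ d a).toReducedWord, (equiv φ d).symm_apply_apply a⟩

/-- The number of stable letters in a reduced word for an element of an HNN extension. -/
noncomputable def stableLength (a : HNNExtension L A B φ) : ℕ :=
  (exists_prod_eq a).choose.toList.length

theorem stableLength_prod (w : ReducedWord L A B) :
    stableLength (w.prod φ) = w.toList.length := by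
  have h := (ReducedWord.map_fst_eq_and_of_prod_eq φ (exists_prod_eq (w.prod φ)).choose_spec).1
  simpa [stableLength] using congrArg List.length h

theorem exists_conj_eq {u : ℤˣ} {g : L} (hg : g ∈ toSubgroup A B u) :
    ∃ g', t ^ (u : ℤ) * of g * t ^ (-(u : ℤ)) = (of g' : HNNExtension L A B φ) := by
  rcases Int.units_eq_one_or u with rfl | rfl
  · exact ⟨φ ⟨g, hg⟩, by simpa using (equiv_eq_conj (φ := φ) ⟨g, hg⟩).symm⟩
  · exact ⟨φ.symm ⟨g, hg⟩, by simpa using (equiv_symm_eq_conj (φ := φ) ⟨g, hg⟩).symm⟩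

theorem exists_append (w v : ReducedWord L A B)
    (h : ∀ x ∈ w.toList.getLast?, ∀ y ∈ v.toList.head?,
      x.2 * v.head ∈ toSubgroup A B x.1 → x.1 = y.1) :
    ∃ r : ReducedWord L A B, r.prod φ = w.prod φ * v.prod φ ∧
      r.toList.map Prod.fst = w.toList.map Prod.fst ++ v.toList.map Prod.fst ∧
      (w.toList = [] → r.head = w.head * v.head) ∧ (w.toList ≠ [] → r.head = w.head) := by
  obtain ⟨hw, l, cw⟩ := w
  obtain ⟨hv, m, cv⟩ := v
  simp only at h
  rcases l.eq_nil_or_concat with rfl | ⟨l, x, rfl⟩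
  · exact ⟨⟨hw * hv, m, cv⟩, by simp [prod_eq, mul_assoc], by simp, by simp, by simp⟩
  · rw [List.concat_eq_append] at *
    refine ⟨⟨hw, l ++ (x.1, x.2 * hv) :: m, ?_⟩, by simp [prod_eq, mul_assoc], by simp, by simp,
      by simp⟩
    rw [List.isChain_append] at cw ⊢
    refine ⟨cw.1, List.isChain_cons.2 ⟨fun y hy => ?_, cv⟩, by simpa using cw.2.2⟩
    exact h x (by simp) y hy

theorem stableLength_mul_lt {w : ReducedWord L A B} {u : ℤˣ} {g g' : L} {l : List (ℤˣ × L)}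
    (hw : w.toList = l ++ [(u, g)]) (h : g * g' ∈ toSubgroup A B u) :
    stableLength (w.prod φ * of g' * t ^ (-(u : ℤ))) < w.toList.length := by
  obtain ⟨k, hk⟩ := exists_conj_eq (φ := φ) h
  have hc := w.chain
  rw [hw] at hc
  obtain ⟨r, hr, hr1, -⟩ := exists_append (φ := φ) ⟨w.head, l, (List.isChain_append.1 hc).1⟩
    ⟨k, [], List.isChain_nil⟩ (by simp)
  have e : w.prod φ * of g' * t ^ (-(u : ℤ)) = r.prod φ := by
    rw [hr]
    simp only [prod_eq, hw, syllableProd_append, syllableProd_cons, syllableProd_nil, ← hk, map_mul]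
    group
  rw [e, stableLength_prod, hw]
  have := congrArg List.length hr1
  simp at this ⊢
  omega

theorem stableLength_mul_lt' {w : ReducedWord L A B} {u : ℤˣ} {g g' : L} {l : List (ℤˣ × L)}
    (hw : w.toList = (u, g) :: l) (h : g' * w.head ∈ toSubgroup A B (-u)) :
    stableLength (t ^ (-(u : ℤ)) * of g' * w.prod φ) < w.toList.length := by
  obtain ⟨k, hk⟩ := exists_conj_eq (φ := φ) h
  have hc := w.chain
  rw [hw] at hc
  have e : t ^ (-(u : ℤ)) * of g' * w.prod φ =
      ReducedWord.prod φ ⟨k * g, l, hc.tail⟩ := by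
    simp only [prod_eq, hw, syllableProd_cons, ← hk, map_mul, Units.val_neg, neg_neg]
    group
  rw [e, stableLength_prod, hw]
  simp

/-- The element of a free group given by a sequence of powers of the second generator separated by
the first generator or its inverse. -/
def syllableWord (j : ℤ) (l : List (ℤˣ × ℤ)) : FreeGroup Bool :=
  FreeGroup.of false ^ j *
    (l.map fun x => FreeGroup.of true ^ (x.1 : ℤ) * FreeGroup.of false ^ x.2).prod

theorem exists_of_true_mul_syllableWord (u : ℤˣ) (j : ℤ) (l : List (ℤˣ × ℤ))
    (hl : l.IsChain fun a b => a.2 = 0 → a.1 = b.1) :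
    ∃ (k : ℤ) (m : List (ℤˣ × ℤ)), (m.IsChain fun a b => a.2 = 0 → a.1 = b.1) ∧
      FreeGroup.of true ^ (u : ℤ) * syllableWord j l = syllableWord k m := by
  by_cases h : j = 0 ∧ ∃ k m, l = (-u, k) :: m
  · obtain ⟨rfl, k, m, rfl⟩ := h
    exact ⟨k, m, hl.tail, by simp [syllableWord, mul_assoc]⟩
  · refine ⟨0, (u, j) :: l, List.isChain_cons.2 ⟨fun y hy hj => ?_, hl⟩, by
      simp [syllableWord, mul_assoc]⟩
    rcases l with _ | ⟨x, l⟩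
    · simp at hy
    · obtain rfl : x = y := by simpa using hy
      by_contra hne
      refine h ⟨hj, x.2, l, ?_⟩
      have : x.1 = -u := by
        rcases Int.units_eq_one_or u with rfl | rfl <;>
          rcases Int.units_eq_one_or x.1 with h | h <;> simp_all
      rw [← this]

theorem exists_eq_syllableWord (f : FreeGroup Bool) :
    ∃ (j : ℤ) (l : List (ℤˣ × ℤ)), (l.IsChain fun a b => a.2 = 0 → a.1 = b.1) ∧
      f = syllableWord j l := by
  obtain ⟨s, rfl⟩ := Quot.exists_rep f
  change ∃ j l, _ ∧ FreeGroup.mk s = _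
  induction s with
  | nil => exact ⟨0, [], List.isChain_nil, by simp [syllableWord, FreeGroup.one_eq_mk]⟩
  | cons a s ih =>
    obtain ⟨j, l, hl, h⟩ := ih
    rw [← List.singleton_append, ← FreeGroup.mul_mk, h]
    obtain ⟨b, e⟩ := a
    have he : ∃ u : ℤˣ, FreeGroup.mk [(b, e)] = FreeGroup.of b ^ (u : ℤ) := by
      cases e
      · exact ⟨-1, by simp [FreeGroup.of, FreeGroup.inv_mk, FreeGroup.invRev]⟩
      · exact ⟨1, by simp [FreeGroup.of]⟩
    obtain ⟨u, hu⟩ := he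
    rw [hu]
    cases b
    · exact ⟨u + j, l, hl, by simp [syllableWord, zpow_add, mul_assoc]⟩
    · obtain ⟨k, m, hm, e⟩ := exists_of_true_mul_syllableWord u j l hl
      exact ⟨k, m, hm, e⟩

/-- The homomorphism from a free group of rank two to an HNN extension sending the generators to the
stable letter and an element of the base group. -/
def freeHom (φ : A ≃* B) (z : L) : FreeGroup Bool →* HNNExtension L A B φ :=
  FreeGroup.lift fun b => cond b t (of z)

@[simp]
theorem freeHom_of_true (z : L) : freeHom φ z (FreeGroup.of true) = t := by simp [freeHom]

@[simp]
theorem freeHom_of_false (z : L) : freeHom φ z (FreeGroup.of false) = of z := by simp [freeHom]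

/-- The reduced word corresponding to `syllableWord`. -/
def zword {z : L} (hz : ∀ (u : ℤˣ) (j : ℤ), z ^ j ∈ toSubgroup A B u → j = 0) (j : ℤ)
    (l : List (ℤˣ × ℤ)) (hl : l.IsChain fun a b => a.2 = 0 → a.1 = b.1) : ReducedWord L A B where
  head := z ^ j
  toList := l.map fun x => (x.1, z ^ x.2)
  chain := (List.isChain_map _).2 (hl.imp fun _ _ h hm => h (hz _ _ hm))

section

variable {z : L} (hz : ∀ (u : ℤˣ) (j : ℤ), z ^ j ∈ toSubgroup A B u → j = 0)

include hz

theorem prod_zword (j : ℤ) (l : List (ℤˣ × ℤ))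
    (hl : l.IsChain fun a b => a.2 = 0 → a.1 = b.1) :
    (zword hz j l hl).prod φ = freeHom φ z (syllableWord j l) := by
  simp only [prod_eq, zword, syllableWord, map_mul, map_zpow, freeHom_of_false]
  congr 1
  clear hl
  induction l with
  | nil => simp
  | cons x l ih => simp [ih]

theorem freeHom_injective : Function.Injective (freeHom φ z) := by
  rw [injective_iff_map_eq_one]
  intro f hf
  obtain ⟨j, l, hl, rfl⟩ := exists_eq_syllableWord f
  rw [← prod_zword hz j l hl] at hf
  have h1 := ReducedWord.toList_eq_nil_of_mem_of_range φ (zword hz j l hl) (hf ▸ one_mem _)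
  obtain rfl : l = [] := by simpa [zword] using h1
  have h2 : z ^ j = 1 := by
    apply of_injective (φ := φ)
    simpa [prod_eq, zword] using hf
  obtain rfl : j = 0 := hz 1 j (h2 ▸ one_mem _)
  simp [syllableWord]

theorem exists_eq_of_minimal {a : HNNExtension L A B φ} {f f' : FreeGroup Bool}
    (h : a * freeHom φ z f = freeHom φ z f' * a) (hf : ∀ j : ℤ, f ≠ FreeGroup.of false ^ j)
    (hmin : ∀ c c', stableLength a ≤ stableLength (freeHom φ z c * a * freeHom φ z c')) :
    ∃ (j j' : ℤ) (u : ℤˣ) (y : L), y ∈ toSubgroup A B u ∧ a = of (z ^ j * y * z ^ j') := by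
  obtain ⟨w, rfl⟩ := exists_prod_eq a
  obtain ⟨j, l, hl, rfl⟩ := exists_eq_syllableWord f
  obtain ⟨j', l', hl', rfl⟩ := exists_eq_syllableWord f'
  have hne : l ≠ [] := by
    rintro rfl
    exact hf j (by simp [syllableWord])
  have right : ∀ x ∈ w.toList.getLast?, ∀ y ∈ (zword hz j l hl).toList.head?,
      x.2 * (zword hz j l hl).head ∈ toSubgroup A B x.1 → x.1 = y.1 := by
    rintro ⟨u, g⟩ hx y - hm
    by_contra hu
    obtain ⟨m, hm'⟩ := List.getLast?_eq_some_iff.1 hx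
    have h1 := stableLength_mul_lt (φ := φ) hm' hm
    have h2 := hmin 1 (FreeGroup.of false ^ j * FreeGroup.of true ^ (-(u : ℤ)))
    simp only [map_one, one_mul, map_mul, map_zpow, freeHom_of_true, freeHom_of_false,
      ← mul_assoc, stableLength_prod, zword] at h1 h2
    omega
  have left : ∀ x ∈ (zword hz j' l' hl').toList.getLast?, ∀ y ∈ w.toList.head?,
      x.2 * w.head ∈ toSubgroup A B x.1 → x.1 = y.1 := by
    rintro ⟨v, g⟩ hx ⟨u, g'⟩ hy hm
    by_contra hu
    obtain rfl : v = -u := by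
      simp only at hu
      rcases Int.units_eq_one_or u with rfl | rfl <;>
        rcases Int.units_eq_one_or v with h | h <;> simp_all
    obtain ⟨m, hm'⟩ : ∃ m, w.toList = (u, g') :: m := by
      rcases hw : w.toList with _ | ⟨x, m⟩
      · simp [hw] at hy
      · exact ⟨m, by simpa [hw] using hy⟩
    obtain ⟨i, rfl⟩ : ∃ i : ℤ, g = z ^ i := by
      have := List.mem_of_mem_getLast? hx
      simp only [zword, List.mem_map, Prod.mk.injEq] at this
      obtain ⟨x, -, -, hx⟩ := this
      exact ⟨x.2, hx.symm⟩
    have h1 := stableLength_mul_lt' (φ := φ) hm' hm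
    have h2 := hmin (FreeGroup.of true ^ (-(u : ℤ)) * FreeGroup.of false ^ i) 1
    simp only [map_one, mul_one, map_mul, map_zpow, freeHom_of_true, freeHom_of_false,
      stableLength_prod] at h1 h2
    omega
  obtain ⟨r, hr, hr1, hr2, hr3⟩ := exists_append (φ := φ) w _ right
  obtain ⟨s, hs, hs1, hs2, hs3⟩ := exists_append (φ := φ) _ w left
  rw [prod_zword] at hr hs
  rw [← hr, ← hs] at h
  obtain ⟨e1, e2⟩ := ReducedWord.map_fst_eq_and_of_prod_eq φ h
  rw [← List.head?_map, hr1] at e2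
  rw [hr1, hs1] at e1
  have hlen := congrArg List.length e1
  simp only [zword, List.map_map, List.length_append, List.length_map] at hlen
  have hne' : l' ≠ [] := by
    rintro rfl
    simp at hlen
    exact hne hlen
  rw [hs3 (by simpa [zword] using hne')] at e2
  rcases hw : w.toList with _ | ⟨⟨u, g⟩, m⟩
  · rw [hr2 hw] at e2
    obtain ⟨x, m, rfl⟩ := List.exists_cons_of_ne_nil hne
    have := e2 x.1 (by simp [hw, zword])
    simp only [zword] at this
    refine ⟨j', -j, -x.1, _, inv_mem this, ?_⟩
    rw [prod_eq, hw, syllableProd_nil, mul_one]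
    congr 1
    group
  · rw [hr3 (by simp [hw])] at e2
    have := e2 u (by simp [hw])
    have h1 := stableLength_mul_lt' (φ := φ) (g' := z ^ (-j')) hw (by
      simpa [zword] using inv_mem this)
    have h2 := hmin (FreeGroup.of true ^ (-(u : ℤ)) * FreeGroup.of false ^ (-j')) 1
    simp only [map_one, mul_one, map_mul, map_zpow, freeHom_of_true, freeHom_of_false,
      stableLength_prod] at h1 h2
    omega

theorem exists_eq_freeHom_mul_mul {a : HNNExtension L A B φ} {f f' : FreeGroup Bool}
    (h : a * freeHom φ z f = freeHom φ z f' * a)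
    (hf : ∀ (c : FreeGroup Bool) (j : ℤ), f ≠ c * FreeGroup.of false ^ j * c⁻¹) :
    ∃ (c c' : FreeGroup Bool) (u : ℤˣ) (y : L), y ∈ toSubgroup A B u ∧
      a = freeHom φ z c * of y * freeHom φ z c' := by
  let F : FreeGroup Bool × FreeGroup Bool → ℕ := fun p =>
    stableLength (freeHom φ z p.1 * a * freeHom φ z p.2)
  obtain ⟨-, ⟨⟨c, c'⟩, rfl⟩, hmin⟩ := (wellFounded_lt (α := ℕ)).has_min (Set.range F) ⟨_, (1, 1), rfl⟩
  have h1 : freeHom φ z c * a * freeHom φ z c' * freeHom φ z (c'⁻¹ * f * c') =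
      freeHom φ z (c * f' * c⁻¹) * (freeHom φ z c * a * freeHom φ z c') := by
    have e := congrArg (fun x => freeHom φ z c * x * freeHom φ z c') h
    simpa [mul_assoc] using e
  have h2 (j : ℤ) : c'⁻¹ * f * c' ≠ FreeGroup.of false ^ j := by
    intro hj
    refine hf c' j ?_
    rw [← hj]
    group
  obtain ⟨j, j', u, y, hy, e⟩ := exists_eq_of_minimal hz h1 h2 fun d d' => by
    have := hmin _ ⟨(d * c, c' * d'), rfl⟩
    simpa [F, mul_assoc] using this
  refine ⟨c⁻¹ * FreeGroup.of false ^ j, FreeGroup.of false ^ j' * c'⁻¹, u, y, hy, ?_⟩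
  rw [map_mul, map_mul] at e
  simp only [map_mul, map_inv, map_zpow, freeHom_of_false] at e ⊢
  calc a = (freeHom φ z c)⁻¹ * (freeHom φ z c * a * freeHom φ z c') * (freeHom φ z c')⁻¹ := by
        group
    _ = _ := by
        rw [e]
        group

end

end HNNExtension

namespace FreeGroup

/-- Doubling, as a permutation of the rational numbers. -/
noncomputable def double : Equiv.Perm ℚ := MulAction.toPerm (Units.mk0 (2 : ℚ) two_ne_zero)

theorem double_apply (y : ℚ) : double y = 2 * y := rfl

theorem double_zpow_apply (k : ℤ) (y : ℚ) : (double ^ k) y = 2 ^ k * y := by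
  have : double = MulAction.toPermHom ℚˣ ℚ (Units.mk0 (2 : ℚ) two_ne_zero) := rfl
  rw [this, ← map_zpow, MulAction.toPermHom_apply, MulAction.toPerm_apply, Units.smul_def]
  simp

theorem addRight_zpow_apply (k : ℤ) (y : ℚ) : (Equiv.addRight (1 : ℚ) ^ k) y = y + k := by
  have h : zpowersHom _ (Equiv.addRight (1 : ℚ)) (Multiplicative.ofAdd k) =
      Equiv.addRight (k : ℚ) := by
    induction k with
    | zero => ext; simp
    | succ i ih =>
      rw [ofAdd_add, _root_.map_mul, ih]
      ext
      simp
      ring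
    | pred i ih =>
      rw [sub_eq_add_neg, ofAdd_add, _root_.map_mul, ih]
      ext
      simp
      ring
  exact DFunLike.congr_fun h y

theorem double_mul_addRight_mul_inv :
    double * Equiv.addRight (1 : ℚ) * double⁻¹ = Equiv.addRight 1 ^ 2 := by
  ext y
  simp only [Equiv.Perm.mul_apply, pow_two, Equiv.coe_addRight]
  rw [double_apply, mul_add, ← double_apply, ← Equiv.Perm.mul_apply, mul_inv_cancel,
    Equiv.Perm.one_apply]
  ring

theorem eq_zero_or_eq_zero_of_zpow_mul_zpow {a b i j : ℤ}
    (h : of true ^ a * of false ^ i = of false ^ j * of true ^ b) : a = 0 ∨ i = 0 := by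
  have h1 := congrArg
    (fun f => lift (fun c => cond c (Equiv.addRight (1 : ℚ)) double) f 0) h
  have h2 := congrArg
    (fun f => lift (fun c => cond c double (Equiv.addRight (1 : ℚ))) f 0) h
  simp only [_root_.map_mul, map_zpow, lift_apply_of, cond_true, cond_false, Equiv.Perm.mul_apply,
    double_zpow_apply, addRight_zpow_apply, mul_zero, zero_add] at h1 h2
  have h3 := congrArg (lift (fun c => cond c (Multiplicative.ofAdd (1 : ℤ)) 1)) h
  have h4 := congrArg (lift (fun c => cond c 1 (Multiplicative.ofAdd (1 : ℤ)))) h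
  simp [← ofAdd_zsmul] at h3 h4
  subst h3 h4
  by_contra! hc
  have h5 : (2 : ℚ) ^ i = 1 := by
    have : (a : ℚ) ≠ 0 := by exact_mod_cast hc.1
    field_simp at h1
    linarith
  rw [zpow_eq_one_iff_right₀ (by norm_num) (by norm_num)] at h5
  exact hc.2 h5

/-- The exponent sum of the first generator. -/
def exponent : FreeGroup Bool →* Multiplicative ℤ :=
  lift fun b => cond b (Multiplicative.ofAdd 1) 1

end FreeGroup

namespace HNNExtension

section

variable {L : Type} [Group L] {x : L}

theorem zpowersHom_injective (hx : ∀ k : ℤ, x ^ k = 1 → k = 0) :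
    Function.Injective (zpowersHom L x) := by
  rw [injective_iff_map_eq_one]
  intro k hk
  exact Multiplicative.toAdd.injective (hx _ hk)

theorem zpowersHom_sq_injective (hx : ∀ k : ℤ, x ^ k = 1 → k = 0) :
    Function.Injective (zpowersHom L (x ^ 2)) := by
  refine zpowersHom_injective fun k hk => ?_
  rw [← zpow_natCast, ← zpow_mul] at hk
  have := hx _ hk
  simpa using this

/-- The isomorphism `x ^ k ↦ x ^ (2 * k)`. -/
noncomputable def squareEquiv (hx : ∀ k : ℤ, x ^ k = 1 → k = 0) :
    (zpowersHom L x).range ≃* (zpowersHom L (x ^ 2)).range :=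
  (MonoidHom.ofInjective (zpowersHom_injective hx)).symm.trans
    (MonoidHom.ofInjective (zpowersHom_sq_injective hx))

theorem squareEquiv_apply (hx : ∀ k : ℤ, x ^ k = 1 → k = 0)
    (y : (zpowersHom L x).range) : (squareEquiv hx y : L) = y ^ 2 := by
  obtain ⟨k, rfl⟩ := (MonoidHom.ofInjective (zpowersHom_injective hx)).surjective y
  simp only [squareEquiv, MulEquiv.trans_apply, MulEquiv.symm_apply_apply,
    MonoidHom.ofInjective_apply, zpowersHom_apply, ← zpow_natCast, ← zpow_mul]
  rw [mul_comm]

/-- The HNN extension in which the stable letter conjugates `x` to `x ^ 2`. -/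
abbrev SquareExtension (hx : ∀ k : ℤ, x ^ k = 1 → k = 0) : Type :=
  HNNExtension L _ _ (squareEquiv hx)

theorem exists_zpow_eq_of_mem_toSubgroup {u : ℤˣ} {y : L}
    (hy : y ∈ toSubgroup (zpowersHom L x).range (zpowersHom L (x ^ 2)).range u) :
    ∃ k : ℤ, y = x ^ k := by
  rcases Int.units_eq_one_or u with rfl | rfl
  · obtain ⟨k, rfl⟩ := hy
    exact ⟨k.toAdd, rfl⟩
  · obtain ⟨k, rfl⟩ := hy
    refine ⟨2 * k.toAdd, ?_⟩
    simp [zpow_mul]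

variable (hx : ∀ k : ℤ, x ^ k = 1 → k = 0)

theorem t_mul_of_mul_inv_t :
    (t * of x * t⁻¹ : SquareExtension hx) = of x ^ 2 := by
  have hm : x ∈ (zpowersHom L x).range := ⟨Multiplicative.ofAdd 1, by simp⟩
  rw [← map_pow]
  exact (equiv_eq_conj (φ := squareEquiv hx) ⟨x, hm⟩).symm.trans
    (congrArg _ (squareEquiv_apply hx ⟨x, hm⟩))

theorem exists_lift {H : Type} [Group H] (f : L →* H) (s : H) (hs : s * f x * s⁻¹ = f x ^ 2) :
    ∃ F : SquareExtension hx →* H, (∀ g, F (of g) = f g) ∧ F t = s := by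
  refine ⟨lift f s ?_, fun g => lift_of _ _ _ g, lift_t _ _ _⟩
  intro y
  rw [squareEquiv_apply]
  obtain ⟨y, k, rfl⟩ := y
  have : s * f (x ^ k.toAdd) * s⁻¹ = f (x ^ k.toAdd) ^ 2 := by
    rw [map_zpow, ← conj_zpow, hs, ← zpow_natCast, ← zpow_natCast, ← zpow_mul, ← zpow_mul,
      mul_comm]
  rw [mul_inv_eq_iff_eq_mul] at this
  simpa using this

variable {z : L} (τ : L →* Multiplicative ℤ) (hτx : τ x = Multiplicative.ofAdd 1) (hτz : τ z = 1)
  (hz : ∀ j : ℤ, z ^ j = 1 → j = 0)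

include hτx hτz hz

theorem eq_zero_of_zpow_mem_toSubgroup (u : ℤˣ) (j : ℤ)
    (h : z ^ j ∈ toSubgroup (zpowersHom L x).range (zpowersHom L (x ^ 2)).range u) : j = 0 := by
  obtain ⟨k, hk⟩ := exists_zpow_eq_of_mem_toSubgroup h
  have h1 := congrArg τ hk
  rw [map_zpow, map_zpow, hτx, hτz, one_zpow, ← ofAdd_zsmul] at h1
  obtain rfl : k = 0 := by simpa using (congrArg Multiplicative.toAdd h1).symm
  exact hz j (by simpa using hk)

theorem mem_range_freeHom_of_exponent_ne {a : SquareExtension hx} {f f' : FreeGroup Bool}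
    (h : a * freeHom (squareEquiv hx) z f = freeHom (squareEquiv hx) z f' * a)
    (hf : FreeGroup.exponent f ≠ 1) : a ∈ (freeHom (squareEquiv hx) z).range := by
  obtain ⟨σ, hσ, hσt⟩ := exists_lift hx (1 : L →* Multiplicative ℤ) (Multiplicative.ofAdd 1)
    (by simp)
  have hexp (f) : σ (freeHom (squareEquiv hx) z f) = FreeGroup.exponent f := by
    rw [← MonoidHom.comp_apply]
    congr 1
    refine FreeGroup.ext_hom _ _ fun b => ?_
    cases b <;> simp [hσ, hσt, FreeGroup.exponent]
  have hff : FreeGroup.exponent f' = FreeGroup.exponent f := by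
    have := congrArg σ h
    rw [map_mul, map_mul, hexp, hexp, mul_comm] at this
    exact (mul_right_cancel this).symm
  obtain ⟨c, c', u, y, hy, rfl⟩ := exists_eq_freeHom_mul_mul
    (eq_zero_of_zpow_mem_toSubgroup τ hτx hτz hz) h (by
      rintro c j rfl
      simp [FreeGroup.exponent] at hf)
  obtain ⟨k, rfl⟩ := exists_zpow_eq_of_mem_toSubgroup hy
  obtain ⟨ρ, hρ, hρt⟩ := exists_lift hx ((zpowersHom _ (Equiv.addRight (1 : ℚ))).comp τ)
    FreeGroup.double (by simpa [hτx] using FreeGroup.double_mul_addRight_mul_inv)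
  have hρf (f) : ρ (freeHom (squareEquiv hx) z f) =
      FreeGroup.double ^ (FreeGroup.exponent f).toAdd := by
    have : ρ.comp (freeHom (squareEquiv hx) z) =
        (zpowersHom _ FreeGroup.double).comp FreeGroup.exponent := by
      refine FreeGroup.ext_hom _ _ fun b => ?_
      cases b <;> simp [hρ, hρt, FreeGroup.exponent, hτz]
    exact DFunLike.congr_fun this f
  have h1 : of (x ^ k) * freeHom (squareEquiv hx) z (c' * f * c'⁻¹) =
      freeHom (squareEquiv hx) z (c⁻¹ * f' * c) * of (x ^ k) := by
    have := congrArg (fun y => (freeHom (squareEquiv hx) z c)⁻¹ * y *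
      (freeHom (squareEquiv hx) z c')⁻¹) h
    simpa [mul_assoc] using this
  have e1 : FreeGroup.exponent (c' * f * c'⁻¹) = FreeGroup.exponent f := by
    simp [mul_comm]
  have e2 : FreeGroup.exponent (c⁻¹ * f' * c) = FreeGroup.exponent f := by
    rw [← hff, map_mul, map_mul, map_inv, mul_comm, mul_inv_cancel_left]
  have h2 := congrArg (fun y => ρ y 0) h1
  simp only [map_mul ρ, hρf, e1, e2] at h2
  simp only [hρ, Equiv.Perm.mul_apply, FreeGroup.double_zpow_apply, MonoidHom.comp_apply, map_zpow,
    hτx, zpowersHom_apply, toAdd_ofAdd, zpow_one, FreeGroup.addRight_zpow_apply, mul_zero,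
    zero_add] at h2
  have h3 : k = 0 := by
    by_contra hk
    have hk' : (k : ℚ) ≠ 0 := by exact_mod_cast hk
    have h4 : (2 : ℚ) ^ (FreeGroup.exponent f).toAdd = 1 := by
      field_simp at h2
      exact h2.symm
    rw [zpow_eq_one_iff_right₀ (by norm_num) (by norm_num)] at h4
    exact hf (Multiplicative.toAdd.injective h4)
  subst h3
  exact ⟨c * c', by simp⟩

end

end HNNExtension

namespace HNNExtension

open NormalWord

section

variable {L : Type} [Group L] {x : L} (hx : ∀ k : ℤ, x ^ k = 1 → k = 0)

theorem exists_conj_zpow_eq {u : ℤˣ} {k : ℤ} (hk : k ≠ 0)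
    (h : x ^ k ∈ toSubgroup (zpowersHom L x).range (zpowersHom L (x ^ 2)).range u) :
    ∃ m : ℤ, m ≠ 0 ∧ t ^ (u : ℤ) * of (x ^ k) = (of (x ^ m) * t ^ (u : ℤ) : SquareExtension hx) := by
  have key (i : ℤ) : (t * of (x ^ i) : SquareExtension hx) = of (x ^ (2 * i)) * t := by
    rw [← mul_inv_eq_iff_eq_mul, map_zpow, map_zpow, ← conj_zpow, t_mul_of_mul_inv_t hx, zpow_mul]
    rfl
  rcases Int.units_eq_one_or u with rfl | rfl
  · exact ⟨2 * k, by simpa using hk, by simpa using key k⟩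
  · obtain ⟨i, hi⟩ := h
    rw [zpowersHom_apply, ← zpow_natCast, ← zpow_mul] at hi
    obtain rfl : k = 2 * i.toAdd := by
      have := hx (k - 2 * i.toAdd) (by rw [zpow_sub, ← hi]; simp)
      omega
    refine ⟨i.toAdd, by simpa using hk, ?_⟩
    rw [Units.val_neg, Units.val_one, zpow_neg_one, eq_mul_inv_iff_mul_eq, mul_assoc, ← key,
      inv_mul_cancel_left]

variable {z : L} (τ : L →* Multiplicative ℤ) (hτx : τ x = Multiplicative.ofAdd 1) (hτz : τ z = 1)
  (hz : ∀ j : ℤ, z ^ j = 1 → j = 0)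
  (hL : ∀ k l j j' : ℤ, x ^ k * z ^ j = z ^ j' * x ^ l → k = 0 ∨ j = 0)

include hτx hτz hz hL

theorem exists_eq_of_true_zpow {k l : ℤ} (hk : k ≠ 0) {c c' : FreeGroup Bool}
    (h : of (x ^ k) * freeHom (squareEquiv hx) z c = freeHom (squareEquiv hx) z c' * of (x ^ l)) :
    ∃ e : ℤ, c = FreeGroup.of true ^ e := by
  have hz' := eq_zero_of_zpow_mem_toSubgroup τ hτx hτz hz
  obtain ⟨j, m, hm, rfl⟩ := exists_eq_syllableWord c
  induction m generalizing k j c' with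
  | nil =>
    obtain ⟨j', m', hm', rfl⟩ := exists_eq_syllableWord c'
    obtain ⟨r, hr, hr1, -, -⟩ := exists_append (φ := squareEquiv hx) (zword hz' j' m' hm')
      ⟨x ^ l, [], List.isChain_nil⟩ (by simp)
    have h0 : ReducedWord.prod (squareEquiv hx) ⟨x ^ k * z ^ j, [], List.isChain_nil⟩ =
        r.prod (squareEquiv hx) := by
      rw [hr, prod_zword]
      simpa [prod_eq, syllableWord] using h
    have h1 := (ReducedWord.map_fst_eq_and_of_prod_eq _ h0).1
    rw [hr1] at h1
    obtain rfl : m' = [] := by simpa [zword] using h1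
    have h2 : x ^ k * z ^ j = z ^ j' * x ^ l := by
      apply of_injective (φ := squareEquiv hx)
      simpa [syllableWord] using h
    obtain rfl := (hL _ _ _ _ h2).resolve_left hk
    exact ⟨0, by simp [syllableWord]⟩
  | cons y m ih =>
    obtain ⟨u, i⟩ := y
    obtain ⟨j', m', hm', hc'⟩ := exists_eq_syllableWord c'
    obtain ⟨r, hr, hr1, -, hr3⟩ := exists_append (φ := squareEquiv hx) (zword hz' j' m' hm')
      ⟨x ^ l, [], List.isChain_nil⟩ (by simp)
    have h0 : ReducedWord.prod (squareEquiv hx)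
        ⟨x ^ k * z ^ j, (zword hz' j _ hm).toList, (zword hz' j _ hm).chain⟩ =
        r.prod (squareEquiv hx) := by
      rw [hr, prod_zword, ← hc']
      simp only [prod_eq, syllableProd_nil, mul_one, ← h]
      rw [← prod_zword hz' _ _ hm, prod_eq]
      simp [zword, mul_assoc]
    obtain ⟨h1, h2⟩ := ReducedWord.map_fst_eq_and_of_prod_eq _ h0
    have hne : m' ≠ [] := by
      rintro rfl
      rw [hr1] at h1
      simp [zword] at h1
    rw [hr3 (by simpa [zword] using hne)] at h2
    have h3 := h2 u (by simp [zword])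
    obtain ⟨p, hp⟩ := exists_zpow_eq_of_mem_toSubgroup h3
    simp only [zword] at hp h3
    have h4 : x ^ (-k) * z ^ j' = z ^ j * x ^ p := by
      rw [← hp]
      group
    obtain rfl := (hL _ _ _ _ h4).resolve_left (by simpa using hk)
    rw [zpow_zero, mul_one] at h4
    have h5 := congrArg τ h4
    rw [map_mul, map_zpow, map_zpow, map_zpow, hτx, hτz, one_zpow, one_mul, ← ofAdd_zsmul,
      ← ofAdd_zsmul] at h5
    obtain rfl : p = -k := by simpa using (congrArg Multiplicative.toAdd h5).symm
    obtain rfl := hz j (by simpa using h4)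
    obtain ⟨n, hn, hn'⟩ := exists_conj_zpow_eq hx (u := -u) hk (by
      simpa using inv_mem h3)
    obtain ⟨e, he⟩ := ih (c' := FreeGroup.of true ^ (-(u : ℤ)) * c') hn i hm.tail (by
      rw [map_mul, mul_assoc, ← h, map_zpow (freeHom _ z), freeHom_of_true]
      have : syllableWord 0 ((u, i) :: m) = FreeGroup.of true ^ (u : ℤ) * syllableWord i m := by
        simp [syllableWord, mul_assoc]
      rw [this, map_mul, ← mul_assoc, ← mul_assoc, map_zpow (freeHom _ z), freeHom_of_true]
      rw [Units.val_neg] at hn'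
      rw [hn']
      group)
    refine ⟨u + e, ?_⟩
    rw [zpow_add, ← he]
    simp [syllableWord, mul_assoc]

theorem mem_range_freeHom_or_exists_eq_conj {a : SquareExtension hx} {f f' : FreeGroup Bool}
    (h : a * freeHom (squareEquiv hx) z f = freeHom (squareEquiv hx) z f' * a) :
    a ∈ (freeHom (squareEquiv hx) z).range ∨
      ∃ (c : FreeGroup Bool) (j : ℤ), f = c * FreeGroup.of false ^ j * c⁻¹ := by
  by_contra! hc
  obtain ⟨ha, hf⟩ := hc
  obtain ⟨c, c', u, y, hy, rfl⟩ := exists_eq_freeHom_mul_mul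
    (eq_zero_of_zpow_mem_toSubgroup τ hτx hτz hz) h hf
  obtain ⟨k, rfl⟩ := exists_zpow_eq_of_mem_toSubgroup hy
  by_cases hk : k = 0
  · subst hk
    exact ha ⟨c * c', by simp⟩
  have h1 : of (x ^ k) * freeHom (squareEquiv hx) z (c' * f * c'⁻¹) =
      freeHom (squareEquiv hx) z (c⁻¹ * f' * c) * of (x ^ k) := by
    have := congrArg (fun y => (freeHom (squareEquiv hx) z c)⁻¹ * y *
      (freeHom (squareEquiv hx) z c')⁻¹) h
    simpa [mul_assoc] using this
  obtain ⟨e, he⟩ := exists_eq_of_true_zpow hx τ hτx hτz hz hL hk h1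
  obtain rfl : f = c'⁻¹ * FreeGroup.of true ^ e * c' := by
    rw [← he]
    group
  refine ha (mem_range_freeHom_of_exponent_ne hx τ hτx hτz hz h fun h0 => hf 1 0 ?_)
  have : Multiplicative.ofAdd (1 : ℤ) ^ e = 1 := by
    rw [map_mul, map_mul, map_inv, mul_comm, mul_inv_cancel_left, map_zpow] at h0
    simpa [FreeGroup.exponent] using h0
  rw [← ofAdd_zsmul] at this
  obtain rfl : e = 0 := by simpa using congrArg Multiplicative.toAdd this
  simp

end

end HNNExtension

/-- The elements `g 0, …, g k` generate the group presented by the relations saying that each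
`g (i + 1)` conjugates `g i` to its square, and `g 0` has infinite order. -/
structure IsHigmanChain {K : Type} [Group K] (g : ℕ → K) (k : ℕ) : Prop where
  rel : ∀ i < k, g (i + 1) * g i * (g (i + 1))⁻¹ = g i ^ 2
  exists_lift {H : Type} [Group H] (a : ℕ → H)
    (ha : ∀ i < k, a (i + 1) * a i * (a (i + 1))⁻¹ = a i ^ 2) : ∃ f : K →* H, ∀ i ≤ k, f (g i) = a i
  hom_ext {H : Type} [Group H] (f f' : K →* H) (h : ∀ i ≤ k, f (g i) = f' (g i)) : f = f'
  eq_zero (j : ℤ) (hj : g 0 ^ j = 1) : j = 0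

/-- The homomorphism from a free group of rank two given by the last and first elements of a
sequence. -/
def endsHom {K : Type} [Group K] (g : ℕ → K) (k : ℕ) : FreeGroup Bool →* K :=
  FreeGroup.lift fun b => cond b (g k) (g 0)

namespace IsHigmanChain

theorem ofAdd_one : IsHigmanChain (fun _ => Multiplicative.ofAdd (1 : ℤ)) 0 where
  rel i hi := by simp at hi
  exists_lift {H} _ a _ := ⟨zpowersHom H (a 0), by simp⟩
  hom_ext f f' h := MonoidHom.ext_mint (h 0 le_rfl)
  eq_zero j hj := by simpa [← ofAdd_zsmul] using congrArg Multiplicative.toAdd hj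

section

variable {K : Type} [Group K] {g : ℕ → K} {k : ℕ} (hg : IsHigmanChain g k)

include hg

theorem exists_exponent : ∃ τ : K →* Multiplicative ℤ,
    τ (g k) = Multiplicative.ofAdd 1 ∧ ∀ i < k, τ (g i) = 1 := by
  obtain ⟨τ, hτ⟩ := hg.exists_lift
    (fun i => if i = k then Multiplicative.ofAdd (1 : ℤ) else 1) (fun i hi => by simp [hi.ne])
  exact ⟨τ, by simpa using hτ k le_rfl, fun i hi => by simpa [hi.ne] using hτ i hi.le⟩

theorem eq_zero_last (j : ℤ) (hj : g k ^ j = 1) : j = 0 := by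
  obtain ⟨τ, hτ, -⟩ := hg.exists_exponent
  have := congrArg τ hj
  rw [map_zpow, hτ, map_one τ, ← ofAdd_zsmul] at this
  simpa using congrArg Multiplicative.toAdd this

theorem notMem_range_endsHom (hk : 2 ≤ k) : g (k - 1) ∉ (endsHom g k).range := by
  obtain ⟨k, rfl⟩ := Nat.exists_eq_add_of_le' hk
  obtain ⟨f, hf⟩ := hg.exists_lift
    (fun i => if i = k + 2 then FreeGroup.double else if i = k + 1 then Equiv.addRight 1 else 1)
    (fun i hi => by
      rcases Nat.lt_succ_iff_lt_or_eq.1 hi with h | rfl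
      · rw [if_neg (by omega : i ≠ k + 2), if_neg (by omega : i ≠ k + 1)]
        simp
      · simpa using FreeGroup.double_mul_addRight_mul_inv)
  rintro ⟨w, hw⟩
  have h1 : f.comp (endsHom g (k + 2)) =
      (zpowersHom _ FreeGroup.double).comp FreeGroup.exponent := by
    refine FreeGroup.ext_hom _ _ fun b => ?_
    cases b <;> simp [endsHom, FreeGroup.exponent, hf]
  have h2 := congrArg (fun y => f y 0) hw
  have h3 := DFunLike.congr_fun (DFunLike.congr_fun h1 w) (0 : ℚ)
  simp only [MonoidHom.comp_apply, zpowersHom_apply, FreeGroup.double_zpow_apply, mul_zero] at h2 h3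
  rw [h3, hf _ (by omega)] at h2
  simp at h2

open HNNExtension

/-- The sequence extended by the stable letter of the corresponding HNN extension. -/
noncomputable def extend (i : ℕ) : SquareExtension hg.eq_zero_last :=
  if i ≤ k then of (g i) else t

theorem extend_of_le {i : ℕ} (hi : i ≤ k) : hg.extend i = of (g i) := if_pos hi

theorem extend_succ : hg.extend (k + 1) = t := if_neg (by omega)

theorem isHigmanChain_extend : IsHigmanChain hg.extend (k + 1) where
  rel i hi := by
    rcases Nat.lt_succ_iff_lt_or_eq.1 hi with h | rfl
    · rw [hg.extend_of_le h, hg.extend_of_le h.le, ← map_inv, ← map_mul, ← map_mul, hg.rel i h,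
        map_pow]
    · rw [hg.extend_of_le le_rfl, hg.extend_succ, t_mul_of_mul_inv_t]
  exists_lift a ha := by
    obtain ⟨f, hf⟩ := hg.exists_lift a fun i hi => ha i (by omega)
    obtain ⟨F, hF, hFt⟩ := HNNExtension.exists_lift hg.eq_zero_last f (a (k + 1)) (by
      rw [hf k le_rfl, ha k (by omega)])
    refine ⟨F, fun i hi => ?_⟩
    rcases Nat.le_succ_iff.1 hi with h | rfl
    · rw [hg.extend_of_le h, hF, hf i h]
    · rw [hg.extend_succ, hFt]
  hom_ext f f' h := by
    refine HNNExtension.hom_ext (hg.hom_ext _ _ fun i hi => ?_) ?_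
    · simpa [hg.extend_of_le hi] using h i (by omega)
    · simpa [hg.extend_succ] using h (k + 1) le_rfl
  eq_zero j hj := by
    rw [hg.extend_of_le (Nat.zero_le _), ← map_zpow] at hj
    exact hg.eq_zero j (of_injective (φ := squareEquiv hg.eq_zero_last) (by rw [hj, map_one]))

theorem endsHom_extend :
    endsHom hg.extend (k + 1) = freeHom (squareEquiv hg.eq_zero_last) (g 0) := by
  refine FreeGroup.ext_hom _ _ fun b => ?_
  cases b <;> simp [endsHom, hg.extend_succ, hg.extend_of_le (Nat.zero_le _)]

theorem endsHom_extend_injective (hk : 0 < k) :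
    Function.Injective (endsHom hg.extend (k + 1)) := by
  obtain ⟨τ, hτ, hτ'⟩ := hg.exists_exponent
  rw [endsHom_extend]
  exact freeHom_injective (eq_zero_of_zpow_mem_toSubgroup τ hτ (hτ' 0 hk) hg.eq_zero)

theorem mem_range_endsHom_extend (hk : 0 < k) {a} {f f' : FreeGroup Bool}
    (h : a * endsHom hg.extend (k + 1) f = endsHom hg.extend (k + 1) f' * a)
    (hf : FreeGroup.exponent f ≠ 1) : a ∈ (endsHom hg.extend (k + 1)).range := by
  obtain ⟨τ, hτ, hτ'⟩ := hg.exists_exponent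
  rw [endsHom_extend] at h ⊢
  exact mem_range_freeHom_of_exponent_ne _ τ hτ (hτ' 0 hk) hg.eq_zero h hf

theorem mem_range_endsHom_extend_or (hk : 0 < k) (hinj : Function.Injective (endsHom g k)) {a}
    {f f' : FreeGroup Bool}
    (h : a * endsHom hg.extend (k + 1) f = endsHom hg.extend (k + 1) f' * a) :
    a ∈ (endsHom hg.extend (k + 1)).range ∨
      ∃ (c : FreeGroup Bool) (j : ℤ), f = c * FreeGroup.of false ^ j * c⁻¹ := by
  obtain ⟨τ, hτ, hτ'⟩ := hg.exists_exponent
  rw [endsHom_extend] at h ⊢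
  refine mem_range_freeHom_or_exists_eq_conj _ τ hτ (hτ' 0 hk) hg.eq_zero ?_ h
  intro p q j j' e
  refine FreeGroup.eq_zero_or_eq_zero_of_zpow_mul_zpow (b := q) (j := j') (hinj ?_)
  simpa [endsHom] using e

end

theorem exists_isHigmanChain (k : ℕ) : ∃ (K : Type) (_ : Group K) (g : ℕ → K),
    IsHigmanChain g k := by
  induction k with
  | zero => exact ⟨_, _, _, ofAdd_one⟩
  | succ k ih =>
    obtain ⟨K, _, g, hg⟩ := ih
    exact ⟨_, _, _, hg.isHigmanChain_extend⟩

theorem exists_isHigmanChain_exponent (k : ℕ) : ∃ (K : Type) (_ : Group K) (g : ℕ → K),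
    IsHigmanChain g (k + 2) ∧ Function.Injective (endsHom g (k + 2)) ∧
      ∀ (a : K) (f f' : FreeGroup Bool), a * endsHom g (k + 2) f = endsHom g (k + 2) f' * a →
        a ∉ (endsHom g (k + 2)).range → FreeGroup.exponent f = 1 := by
  obtain ⟨K, _, g, hg⟩ := exists_isHigmanChain (k + 1)
  refine ⟨_, _, _, hg.isHigmanChain_extend, hg.endsHom_extend_injective k.succ_pos,
    fun a f f' h ha => ?_⟩
  contrapose! ha
  exact hg.mem_range_endsHom_extend k.succ_pos h ha

theorem exists_isHigmanChain_conj (k : ℕ) : ∃ (K : Type) (_ : Group K) (g : ℕ → K),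
    IsHigmanChain g (k + 3) ∧ Function.Injective (endsHom g (k + 3)) ∧
      ∀ (a : K) (f f' : FreeGroup Bool), a * endsHom g (k + 3) f = endsHom g (k + 3) f' * a →
        a ∉ (endsHom g (k + 3)).range → ∃ c, ∃ j : ℤ, f = c * FreeGroup.of false ^ j * c⁻¹ := by
  obtain ⟨K, _, g, hg, hinj, -⟩ := exists_isHigmanChain_exponent k
  exact ⟨_, _, _, hg.isHigmanChain_extend, hg.endsHom_extend_injective (Nat.succ_pos _),
    fun a f f' h ha => (hg.mem_range_endsHom_extend_or (Nat.succ_pos _) hinj h).resolve_left ha⟩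

end IsHigmanChain

namespace Amalgam

open Monoid

section

variable {H A B : Type} [Group H] [Group A] [Group B]

/-- The family of groups consisting of `A` and `B`. -/
def Factor (A B : Type) (b : Bool) : Type := cond b A B

instance : ∀ b, Group (Factor A B b)
  | true => inferInstanceAs (Group A)
  | false => inferInstanceAs (Group B)

/-- The family of homomorphisms consisting of `α` and `β`. -/
def factorHom (α : H →* A) (β : H →* B) : ∀ b, H →* Factor A B b
  | true => α
  | false => β

variable (α : H →* A) (β : H →* B)

/-- The inclusion of the first factor of an amalgamated product. -/
def inl : A →* PushoutI (factorHom α β) := PushoutI.of (G := Factor A B) true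

/-- The inclusion of the second factor of an amalgamated product. -/
def inr : B →* PushoutI (factorHom α β) := PushoutI.of (G := Factor A B) false

theorem inl_apply (h : H) : inl α β (α h) = PushoutI.base (factorHom α β) h :=
  PushoutI.of_apply_eq_base (factorHom α β) true h

theorem inr_apply (h : H) : inr α β (β h) = PushoutI.base (factorHom α β) h :=
  PushoutI.of_apply_eq_base (factorHom α β) false h

variable {α β}

theorem exists_lift {K : Type} [Group K] (f : A →* K) (f' : B →* K) (h : f.comp α = f'.comp β) :
    ∃ F : PushoutI (factorHom α β) →* K, (∀ a, F (inl α β a) = f a) ∧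
      ∀ b, F (inr α β b) = f' b :=
  ⟨PushoutI.lift (G := Factor A B) (fun | true => f | false => f') (f.comp α) (by
    rintro (_ | _)
    · exact h.symm
    · rfl), fun _ => PushoutI.lift_of (G := Factor A B) _ _ _ _,
    fun _ => PushoutI.lift_of (G := Factor A B) _ _ _ _⟩

theorem hom_ext {K : Type} [Group K] {F F' : PushoutI (factorHom α β) →* K}
    (h : F.comp (inl α β) = F'.comp (inl α β)) (h' : F.comp (inr α β) = F'.comp (inr α β)) :
    F = F' := by
  refine PushoutI.hom_ext_nonempty fun b => ?_
  cases b
  · exact h'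
  · exact h

theorem factorHom_injective (hα : Function.Injective α) (hβ : Function.Injective β) (b : Bool) :
    Function.Injective (factorHom α β b) := by
  cases b
  · exact hβ
  · exact hα

theorem exists_isAcylindricalTreeLength (hα : Function.Injective α) (hβ : Function.Injective β)
    (hα' : ∃ a, a ∉ α.range) (hβ' : ∃ b, b ∉ β.range)
    (h : ∀ (a : A) (b : B) (c c' d : H), a ∉ α.range → b ∉ β.range → a * α d = α c * a →
      b * β d = β c' * b → d = 1) :
    ∃ ℓ : PushoutI (factorHom α β) → ℕ, IsAcylindricalTreeLength ℓ := by
  obtain ⟨d⟩ := PushoutI.NormalWord.transversal_nonempty (factorHom α β) (factorHom_injective hα hβ)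
  refine ⟨length d, isAcylindricalTreeLength d ?_ ?_⟩
  · rintro (_ | _)
    · exact hβ'
    · exact hα'
  · rintro (_ | _) (_ | _) a b e hij ha hb ⟨c, hc⟩ ⟨c', hc'⟩
    · exact absurd rfl hij
    · exact h (b⁻¹ : A) a c' c e (fun hm => hb (inv_mem_iff.1 hm)) ha
        ((eq_mul_inv_iff_mul_eq (G := A)).2 hc'.symm) ((mul_inv_eq_iff_eq_mul (G := B)).1 hc.symm)
    · exact h a (b⁻¹ : B) c c' e ha (fun hm => hb (inv_mem_iff.1 hm))
        ((mul_inv_eq_iff_eq_mul (G := A)).1 hc.symm) ((eq_mul_inv_iff_mul_eq (G := B)).2 hc'.symm)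
    · exact absurd rfl hij

end

end Amalgam

theorem IsAcylindricalTreeLength.comp_mulEquiv {G G' : Type} [Group G] [Group G'] {ℓ : G' → ℕ}
    (hℓ : IsAcylindricalTreeLength ℓ) (e : G ≃* G') :
    IsAcylindricalTreeLength fun g => ℓ (e g) where
  one := by rw [map_one, hℓ.one]
  inv g := by rw [map_inv, hℓ.inv]
  four_point x y z := by simpa using hℓ.four_point (e x) (e y) (e z)
  exists_prefix g k hk := by
    obtain ⟨p, hp⟩ := hℓ.exists_prefix (e g) k hk
    exact ⟨e.symm p, by simpa using hp⟩
  eq_one a b c ha hb hab hc hac hbc := by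
    have := hℓ.eq_one (e a) (e b) (e c) ha hb (by simpa using hab) hc (by simpa using hac)
      (by simpa using hbc)
    simpa using this
  unbounded N := by
    obtain ⟨g, hg⟩ := hℓ.unbounded N
    exact ⟨e.symm g, by simpa using hg⟩

theorem not_isVirtuallyCyclic_of_injective {G : Type} [Group G] (f : FreeGroup Bool →* G)
    (hf : Function.Injective f) : ¬IsVirtuallyCyclic G := by
  rintro ⟨H, hH, hfin⟩
  obtain ⟨p, hp, -, hp'⟩ := H.exists_pow_mem_of_index_ne_zero hfin.index_ne_zero
    (f (FreeGroup.of true))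
  obtain ⟨q, hq, -, hq'⟩ := H.exists_pow_mem_of_index_ne_zero hfin.index_ne_zero
    (f (FreeGroup.of false))
  have h := congrArg Subtype.val (IsCyclic.isMulCommutative.is_comm.comm (⟨_, hp'⟩ : H) ⟨_, hq'⟩)
  simp only [Subgroup.coe_mul, ← map_pow, ← map_mul] at h
  have h1 := hf h
  rcases FreeGroup.eq_zero_or_eq_zero_of_zpow_mul_zpow (a := p) (b := p) (i := q) (j := q)
    (by simpa using h1) with h | h <;> omega

namespace IsHigmanChain

open Amalgam Monoid

section

variable {A B : Type} [Group A] [Group B] {g : ℕ → A} {g' : ℕ → B} {m : ℕ}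

/-- The homomorphism `endsHom` with the two generators of the free group exchanged. -/
def endsHomSwap (g : ℕ → B) (m : ℕ) : FreeGroup Bool →* B :=
  (endsHom g m).comp (FreeGroup.map Bool.not)

/-- The amalgamated product of two groups along the free subgroups generated by the ends of two
sequences. -/
abbrev EndsAmalgam (g : ℕ → A) (g' : ℕ → B) (m : ℕ) : Type :=
  PushoutI (factorHom (endsHom g 2) (endsHomSwap g' m))

theorem inl_two : (inl _ _ (g 2) : EndsAmalgam g g' m) = inr _ _ (g' 0) := by
  have h1 := inl_apply (endsHom g 2) (endsHomSwap g' m) (FreeGroup.of true)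
  rw [← inr_apply] at h1
  simpa [endsHom, endsHomSwap] using h1

theorem inl_zero : (inl _ _ (g 0) : EndsAmalgam g g' m) = inr _ _ (g' m) := by
  have h1 := inl_apply (endsHom g 2) (endsHomSwap g' m) (FreeGroup.of false)
  rw [← inr_apply] at h1
  simpa [endsHom, endsHomSwap] using h1

end

theorem higman_rel (n : ℕ) (i : ZMod n) :
    (PresentedGroup.of i * PresentedGroup.of (i + 1) * (PresentedGroup.of i)⁻¹ : HigmanGroup n) =
      PresentedGroup.of (i + 1) ^ 2 := by
  have : PresentedGroup.mk (higmanRels n) (FreeGroup.of i * FreeGroup.of (i + 1) *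
      (FreeGroup.of i)⁻¹ * ((FreeGroup.of (i + 1))⁻¹) ^ 2) = 1 :=
    PresentedGroup.one_of_mem ⟨i, rfl⟩
  rw [map_mul, map_pow, map_inv, inv_pow, mul_inv_eq_one] at this
  exact this

theorem exists_hom_higman {n : ℕ} {P : Type} [Group P] (v : ZMod n → P)
    (hv : ∀ i, v i * v (i + 1) * (v i)⁻¹ = v (i + 1) ^ 2) :
    ∃ f : HigmanGroup n →* P, ∀ i, f (PresentedGroup.of i) = v i := by
  refine ⟨PresentedGroup.toGroup (f := v) ?_, fun i => PresentedGroup.toGroup.of _⟩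
  rintro r ⟨i, rfl⟩
  rw [map_mul, map_pow, map_inv, inv_pow, mul_inv_eq_one]
  simpa using hv i

variable {A B : Type} [Group A] [Group B] {g : ℕ → A} {g' : ℕ → B} {m : ℕ}

theorem nonempty_mulEquiv (hm : 0 < m) (hg : IsHigmanChain g 2) (hg' : IsHigmanChain g' m) :
    Nonempty (HigmanGroup (m + 2) ≃* EndsAmalgam g g' m) := by
  let v : ZMod (m + 2) → EndsAmalgam g g' m := fun i =>
    if i.val ≤ m then inr _ _ (g' (m - i.val)) else inl _ _ (g 1)
  have v_of_le (j : ℕ) (hj : j ≤ m) : v j = inr _ _ (g' (m - j)) := by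
    simp only [v, ZMod.val_natCast, Nat.mod_eq_of_lt (by omega : j < m + 2), if_pos hj]
  have v_last : v (m + 1 : ℕ) = inl _ _ (g 1) := by
    simp only [v, ZMod.val_natCast, Nat.mod_eq_of_lt (by omega : m + 1 < m + 2)]
    rw [if_neg (by omega)]
  have cast_zero : ((m + 1 : ℕ) : ZMod (m + 2)) + 1 = (0 : ℕ) := by
    have := ZMod.natCast_self (m + 2)
    push_cast at this ⊢
    rw [← this]
    ring
  obtain ⟨f, hf⟩ := exists_hom_higman v fun i => by
    have hi : i.val < m + 2 := ZMod.val_lt i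
    rw [← ZMod.natCast_zmod_val i]
    generalize i.val = j at hi
    rcases lt_trichotomy j m with h | rfl | h
    · obtain ⟨k, rfl⟩ := Nat.exists_eq_add_of_lt h
      rw [← Nat.cast_succ, v_of_le _ (by omega), v_of_le _ (by omega), ← map_inv, ← map_mul,
        ← map_mul, ← map_pow, (by omega : j + k + 1 - j = k + 1), (by omega : j + k + 1 - j.succ = k),
        hg'.rel k (by omega)]
    · rw [← Nat.cast_succ, v_of_le _ le_rfl, v_last, Nat.sub_self, ← inl_two, ← map_inv, ← map_mul,
        ← map_mul, ← map_pow, hg.rel 1 (by omega)]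
    · obtain rfl : j = m + 1 := by omega
      rw [cast_zero, v_of_le _ (Nat.zero_le _), v_last, Nat.sub_zero, ← inl_zero, ← map_inv,
        ← map_mul, ← map_mul, ← map_pow, hg.rel 0 (by omega)]
  let a (j : ℕ) : HigmanGroup (m + 2) := PresentedGroup.of (j : ZMod (m + 2))
  have ha (j : ℕ) : a j * a (j + 1) * (a j)⁻¹ = a (j + 1) ^ 2 := by
    simpa [a] using higman_rel (m + 2) (j : ZMod (m + 2))
  have ha' : a (m + 1) * a 0 * (a (m + 1))⁻¹ = a 0 ^ 2 := by
    have := higman_rel (m + 2) ((m + 1 : ℕ) : ZMod (m + 2))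
    rwa [cast_zero] at this
  obtain ⟨p, hp⟩ := hg.exists_lift
    (fun | 0 => a 0 | 1 => a (m + 1) | _ => a m) (by
      intro i hi
      interval_cases i
      · exact ha'
      · exact ha m)
  obtain ⟨p', hp'⟩ := hg'.exists_lift (fun i => a (m - i)) (by
    intro i hi
    have := ha (m - (i + 1))
    rwa [(by omega : m - (i + 1) + 1 = m - i)] at this)
  have hp0 : p (g 0) = a 0 := hp 0 (by omega)
  have hp1 : p (g 1) = a (m + 1) := hp 1 (by omega)
  have hp2 : p (g 2) = a m := hp 2 (by omega)
  obtain ⟨q, hq, hq'⟩ := Amalgam.exists_lift (α := endsHom g 2) (β := endsHomSwap g' m) p p' (by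
    refine FreeGroup.ext_hom _ _ fun b => ?_
    cases b
    · simp [endsHom, endsHomSwap, hp0, hp']
    · simp [endsHom, endsHomSwap, hp2, hp'])
  have hfa (j : ℕ) : f (a j) = v j := hf _
  refine ⟨MonoidHom.toMulEquiv f q ?_ ?_⟩
  · refine PresentedGroup.ext fun i => ?_
    have hi : i.val < m + 2 := ZMod.val_lt i
    rw [← ZMod.natCast_zmod_val i]
    generalize i.val = j at hi
    change q (f (a j)) = a j
    rw [hfa]
    rcases Nat.lt_or_ge m j with h | h
    · obtain rfl : j = m + 1 := by omega
      rw [v_last, hq, hp1]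
    · rw [v_of_le j h, hq', hp' _ (by omega)]
      congr 1
      omega
  · refine Amalgam.hom_ext (hg.hom_ext _ _ fun i hi => ?_) (hg'.hom_ext _ _ fun i hi => ?_)
    · change f (q (inl _ _ (g i))) = inl _ _ (g i)
      rw [hq]
      interval_cases i
      · rw [hp0, hfa, v_of_le _ (Nat.zero_le _), inl_zero, Nat.sub_zero]
      · rw [hp1, hfa, v_last]
      · rw [hp2, hfa, v_of_le _ le_rfl, inl_two, Nat.sub_self]
    · change f (q (inr _ _ (g' i))) = inr _ _ (g' i)
      rw [hq', hp' i hi, hfa, v_of_le _ (by omega)]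
      congr 3
      omega

end IsHigmanChain

open IsHigmanChain Amalgam Monoid in
theorem exists_isAcylindricalTreeLength_higmanGroup (k : ℕ) :
    ¬IsVirtuallyCyclic (HigmanGroup (k + 5)) ∧
      ∃ ℓ : HigmanGroup (k + 5) → ℕ, IsAcylindricalTreeLength ℓ := by
  obtain ⟨A, _, g, hg, hinj, hA⟩ := exists_isHigmanChain_exponent 0
  obtain ⟨B, _, g', hg', hinj', hB⟩ := exists_isHigmanChain_conj k
  rw [zero_add] at *
  obtain ⟨e⟩ : Nonempty (HigmanGroup (k + 5) ≃* EndsAmalgam g g' (k + 3)) :=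
    nonempty_mulEquiv (Nat.succ_pos _) hg hg'
  have hswap : Function.Involutive (FreeGroup.map Bool.not) := DFunLike.congr_fun
    (FreeGroup.ext_hom ((FreeGroup.map Bool.not).comp (FreeGroup.map Bool.not)) (MonoidHom.id _)
      (by simp))
  have hrange : (endsHomSwap g' (k + 3)).range = (endsHom g' (k + 3)).range := by
    rw [endsHomSwap, MonoidHom.range_comp, MonoidHom.range_eq_top.2 hswap.surjective,
      MonoidHom.range_eq_map]
  have hinj'' : Function.Injective (endsHomSwap g' (k + 3)) := hinj'.comp hswap.injective
  constructor
  · refine not_isVirtuallyCyclic_of_injective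
      (e.symm.toMonoidHom.comp (PushoutI.base (factorHom (endsHom g 2) (endsHomSwap g' (k + 3)))))
      (e.symm.injective.comp (PushoutI.base_injective (factorHom_injective hinj hinj'')))
  · obtain ⟨ℓ, hℓ⟩ := exists_isAcylindricalTreeLength (α := endsHom g 2)
      (β := endsHomSwap g' (k + 3)) hinj hinj'' ⟨_, hg.notMem_range_endsHom le_rfl⟩
      ⟨_, hrange ▸ hg'.notMem_range_endsHom (by omega)⟩ (by
        intro a b c c' d ha hb hac hbc
        have h1 := hA a d c hac ha
        obtain ⟨y, j, hy⟩ := hB b _ _ hbc (hrange ▸ hb)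
        obtain rfl : d = FreeGroup.map Bool.not y * FreeGroup.of true ^ j *
            (FreeGroup.map Bool.not y)⁻¹ := by
          rw [← hswap d, hy]
          simp
        rw [map_mul, map_mul, map_inv, mul_comm, inv_mul_cancel_left, map_zpow,
          FreeGroup.exponent, FreeGroup.lift_apply_of, cond_true, ← ofAdd_zsmul] at h1
        obtain rfl : j = 0 := by simpa using congrArg Multiplicative.toAdd h1
        simp)
    exact ⟨_, hℓ.comp_mulEquiv e⟩

theorem higman_acylindrically_hyperbolic (n : ℕ) (hn : 5 ≤ n) :
    IsAcylindricallyHyperbolic (HigmanGroup n) := by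
  obtain ⟨k, rfl⟩ := Nat.exists_eq_add_of_le' hn
  obtain ⟨h, ℓ, hℓ⟩ := exists_isAcylindricalTreeLength_higmanGroup k
  exact ⟨h, _, _, _, IsAcylindricalTreeLength.goodAcylAction_act (ℓ := ℓ)⟩
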